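/- Let K be a number field or a function field of characteristic 0, let n ≥ 2, let f ∈ K[X] be a polynomial of degree at least 2, and let φ = (f,…,f) : (P^1_K)^n → (P^1_K)^n. Let V be a zero-dimensional closed subvariety of (P^1_K)^n. For every point P ∈ (P^1)^n(K) whose forward orbit O_φ(P) does not intersect V(K), there exist infinitely many non-archimedean places 𝔭 of K such that V(K_𝔭) does not intersect the 𝔭-adic closure of O_φ(P) in (P^1)^n(K_𝔭). -/

import Mathlib

open Polynomial OnePoint

/-- Action of a polynomial on the projective line `P^1(L) = L ∪ {∞}`:
`∞ ↦ ∞` and `a ↦ f(a)`. -/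
def polyEvalP1 {L : Type} [CommRing L] (f : Polynomial L) : OnePoint L → OnePoint L :=
  OnePoint.map fun a => f.eval a

/-- The diagonally split self-map `(f,…,f)` of `(P^1)^n` (coordinatewise action). -/
def splitMap {L : Type} [CommRing L] {ι : Type} (f : Polynomial L)
    (x : ι → OnePoint L) : ι → OnePoint L :=
  fun i => polyEvalP1 f (x i)

/-- The forward orbit of a point under a self-map. -/
def fwdOrbit {X : Type*} (φ : X → X) (P : X) : Set X :=
  Set.range fun k : ℕ => φ^[k] P

/-- Homogeneous coordinates of a point of `P^1(L)`: `a ↦ (a, 1)`, `∞ ↦ (1, 0)`. -/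
def homCoords {L : Type} [CommRing L] (x : OnePoint L) : Fin 2 → L :=
  Option.elim x ![1, 0] (fun a => ![a, 1])

/-- A polynomial in variables `(i, 0), (i, 1)` (`i : ι`) is multihomogeneous if it is
homogeneous in the pair of variables indexed by each `i` separately. -/
def MultiHomog {K : Type} [CommSemiring K] {ι : Type} [DecidableEq ι]
    (p : MvPolynomial (ι × Fin 2) K) : Prop :=
  ∀ i : ι, ∃ d : ℕ,
    p.IsWeightedHomogeneous (fun jk => if jk.1 = i then (1 : ℕ) else 0) d

/-- A closed subvariety of `(P^1_K)^ι`, given by a set of multihomogeneous equations over `K`. -/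
structure ClosedSubvar (K : Type) [CommRing K] (ι : Type) [DecidableEq ι] where
  polys : Set (MvPolynomial (ι × Fin 2) K)
  homog : ∀ p ∈ polys, MultiHomog p

/-- Whether a multihomogeneous polynomial vanishes at a point of `(P^1(L))^ι`. -/
def vanishesAt {K : Type} [CommRing K] {ι : Type} [DecidableEq ι] {L : Type} [CommRing L]
    (φ : K →+* L) (p : MvPolynomial (ι × Fin 2) K) (x : ι → OnePoint L) : Prop :=
  MvPolynomial.eval (fun jk => homCoords (x jk.1) jk.2) (MvPolynomial.map φ p) = 0

/-- The `L`-points of a closed subvariety, for a `K`-algebra `L` via `φ : K →+* L`. -/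
def ClosedSubvar.pts {K : Type} [CommRing K] {ι : Type} [DecidableEq ι]
    (V : ClosedSubvar K ι) {L : Type} [CommRing L] (φ : K →+* L) :
    Set (ι → OnePoint L) :=
  {x | ∀ p ∈ V.polys, vanishesAt φ p x}

/-- A subset of `(P^1(L))^ι` is Zariski closed if it is the common zero set of a family of
multihomogeneous polynomials over `L`. -/
def IsZarClosed {L : Type} [CommRing L] {ι : Type} [DecidableEq ι]
    (S : Set (ι → OnePoint L)) : Prop :=
  ∃ V : ClosedSubvar L ι, S = V.pts (RingHom.id L)

/-- The Zariski closure of a set of points. -/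
def zarClosure {L : Type} [CommRing L] {ι : Type} [DecidableEq ι]
    (S : Set (ι → OnePoint L)) : Set (ι → OnePoint L) :=
  ⋂₀ {Z | IsZarClosed Z ∧ S ⊆ Z}

/-- An irreducible (closed) subvariety of `(P^1(L))^ι`, as a set of points. -/
def IrrSubvar {L : Type} [CommRing L] {ι : Type} [DecidableEq ι]
    (S : Set (ι → OnePoint L)) : Prop :=
  S.Nonempty ∧ IsZarClosed S ∧
    ∀ Z₁ Z₂ : Set (ι → OnePoint L), IsZarClosed Z₁ → IsZarClosed Z₂ →
      S ⊆ Z₁ ∪ Z₂ → S ⊆ Z₁ ∨ S ⊆ Z₂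

/-- The dimension of a (closed) subvariety, as the Krull dimension of the poset of
irreducible closed subsets contained in it. -/
noncomputable def varDim {L : Type} [CommRing L] {ι : Type} [DecidableEq ι]
    (S : Set (ι → OnePoint L)) : WithBot ℕ∞ :=
  Order.krullDim {T : Set (ι → OnePoint L) // IrrSubvar T ∧ T ⊆ S}

/-- `T` is an irreducible component of `S`: a maximal irreducible closed subset of `S`. -/
def IsComponentOf {L : Type} [CommRing L] {ι : Type} [DecidableEq ι]
    (T S : Set (ι → OnePoint L)) : Prop :=
  IrrSubvar T ∧ T ⊆ S ∧ ∀ T', IrrSubvar T' → T ⊆ T' → T' ⊆ S → T' = T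

/-- A hypersurface in `(P^1(L))^n`: a nonempty Zariski closed set all of whose irreducible
components have dimension `n - 1`. -/
def IsHypersurfaceSet {L : Type} [CommRing L] {n : ℕ}
    (S : Set (Fin n → OnePoint L)) : Prop :=
  S.Nonempty ∧ IsZarClosed S ∧
    ∀ T, IsComponentOf T S → varDim T = ((n - 1 : ℕ) : ℕ∞)

/-- A set of points (e.g. a subvariety) is periodic under the split map `(f,…,f)`. -/
def SubvarPeriodic {L : Type} [CommRing L] {ι : Type} (f : Polynomial L)
    (S : Set (ι → OnePoint L)) : Prop :=
  ∃ m : ℕ, 1 ≤ m ∧ (splitMap f)^[m] '' S = S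

/-- A set of points (e.g. a subvariety) is preparation under `(f,…,f)`. -/
def SubvarPreperiodic {L : Type} [CommRing L] {ι : Type} (f : Polynomial L)
    (S : Set (ι → OnePoint L)) : Prop :=
  ∃ k : ℕ, SubvarPeriodic f ((splitMap f)^[k] '' S)

/-- A place of a field `K`, represented by a nontrivial absolute value. -/
structure PlaceK (K : Type) [Field K] where
  v : AbsoluteValue K ℝ
  nontrivial : ∃ x : K, x ≠ 0 ∧ v x ≠ 1

/-- A place is non-archimedean if its absolute value satisfies the ultrametric inequality. -/
def PlaceK.IsNonarch {K : Type} [Field K] (w : PlaceK K) : Prop :=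
  ∀ x y : K, w.v (x + y) ≤ max (w.v x) (w.v y)

/-- Equivalence of places (equality of the associated topologies / unit balls). -/
def PlaceK.Equiv {K : Type} [Field K] (w w' : PlaceK K) : Prop :=
  ∀ x : K, w.v x < 1 ↔ w'.v x < 1

/-- A choice of completion of `K` at a place `w`: a field `carrier` with an absolute value
extending that of `w` through `emb`, which is complete and in which `K` is dense. -/
structure CompletionOf {K : Type} [Field K] (w : PlaceK K) where
  carrier : Type
  [field : Field carrier]
  emb : K →+* carrier
  absv : AbsoluteValue carrier ℝ
  compat : ∀ x : K, absv (emb x) = w.v x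
  complete : ∀ s : ℕ → carrier,
    (∀ ε : ℝ, 0 < ε → ∃ N : ℕ, ∀ m ≥ N, ∀ k ≥ N, absv (s m - s k) < ε) →
    ∃ a : carrier, ∀ ε : ℝ, 0 < ε → ∃ N : ℕ, ∀ m ≥ N, absv (s m - a) < ε
  dense : ∀ a : carrier, ∀ ε : ℝ, 0 < ε → ∃ x : K, absv (a - emb x) < ε

attribute [instance] CompletionOf.field

/-- The chordal metric on `P^1(L)` attached to an absolute value on `L`. -/
noncomputable def p1Dist {L : Type} [Field L] (w : AbsoluteValue L ℝ) :
    OnePoint L → OnePoint L → ℝ :=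
  fun x y =>
    Option.elim x
      (Option.elim y 0 fun b => 1 / max 1 (w b))
      (fun a => Option.elim y (1 / max 1 (w a))
        (fun b => w (a - b) / (max 1 (w a) * max 1 (w b))))

/-- The topology on `P^1(L)` generated by the balls of the chordal metric. -/
noncomputable def p1Top {L : Type} [Field L] (w : AbsoluteValue L ℝ) :
    TopologicalSpace (OnePoint L) :=
  TopologicalSpace.generateFrom
    {U | ∃ (x : OnePoint L) (ε : ℝ), 0 < ε ∧ U = {y | p1Dist w x y < ε}}

/-- The topology on `(P^1(L))^ι` induced by the chordal metric topology on each factor. -/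
noncomputable def pnTop {L : Type} [Field L] (ι : Type) (w : AbsoluteValue L ℝ) :
    TopologicalSpace (ι → OnePoint L) :=
  @Pi.topologicalSpace ι (fun _ => OnePoint L) (fun _ => p1Top w)

/-- The closure of a set of points of `(P^1(L))^ι` in the topology induced by an
absolute value on `L`. -/
noncomputable def adicClosure {L : Type} [Field L] {ι : Type} (w : AbsoluteValue L ℝ)
    (S : Set (ι → OnePoint L)) : Set (ι → OnePoint L) :=
  @closure _ (pnTop ι w) S

/-- Base change of a point of `P^1(K)` along a field embedding. -/
def mapPoint {K L : Type} [Field K] [Field L] (φ : K →+* L) :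
    OnePoint K → OnePoint L :=
  OnePoint.map φ

/-- `K` is a number field, or a function field of characteristic zero over the ground
field `κ` (finitely generated of transcendence degree 1 over `κ`, with `κ` relatively
algebraically closed in `K`). -/
def NumberFieldOrFunctionFieldOver (K : Type) [Field K] (κ : Subfield K) : Prop :=
  NumberField K ∨
    (CharZero K ∧
      (∃ t : K, Transcendental κ t ∧
        FiniteDimensional (IntermediateField.adjoin κ {t}) K) ∧
      (∀ x : K, IsAlgebraic κ x → x ∈ κ))

/-- The places of `K` relevant for the theorems: in the number field case all places are
allowed; in the function field case only places trivial on the ground field `κ`. -/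
def PlaceK.IsPlaceOver {K : Type} [Field K] (κ : Subfield K) (w : PlaceK K) : Prop :=
  NumberField K ∨ (∀ c : K, c ∈ κ → c ≠ 0 → w.v c = 1)

/-- At the place `w`, the `w`-adic closure of the `(f,…,f)`-orbit of `P` does not meet
`V(K_w)`: for every completion of `K` at `w`, the `w`-adic closure of the orbit in
`(P^1)^n` of the completion is disjoint from the set of points of `V` over the
completion. -/
def OrbitClosureAvoids {K : Type} [Field K] {n : ℕ} (w : PlaceK K)
    (f : Polynomial K) (P : Fin n → OnePoint K) (V : ClosedSubvar K (Fin n)) : Prop :=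
  ∀ C : CompletionOf w,
    adicClosure C.absv
        (fwdOrbit (splitMap (f.map C.emb)) fun i => mapPoint C.emb (P i)) ∩
      V.pts C.emb = ∅

/-- There are infinitely many (pairwise inequivalent) non-archimedean places of `K`
(trivial on the ground field `κ` in the function field case) satisfying `Q`. -/
def InfinitelyManyPlaces (K : Type) [Field K] (κ : Subfield K)
    (Q : PlaceK K → Prop) : Prop :=
  ∃ T : Set (PlaceK K), T.Infinite ∧
    (T.Pairwise fun w w' => ¬ PlaceK.Equiv w w') ∧
    ∀ w ∈ T, w.IsNonarch ∧ w.IsPlaceOver κ ∧ Q w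

/-- All but finitely many non-archimedean places of `K` (trivial on the ground field `κ`
in the function field case) satisfy `Q`. -/
def AllButFinitelyManyPlaces (K : Type) [Field K] (κ : Subfield K)
    (Q : PlaceK K → Prop) : Prop :=
  ∃ T : Set (PlaceK K), T.Finite ∧
    ∀ w : PlaceK K, w.IsNonarch → w.IsPlaceOver κ →
      (∃ w' ∈ T, PlaceK.Equiv w w') ∨ Q w

section DividedDifference

variable {A B : Type*} [CommRing A] [CommRing B]

/-- The divided difference `(f(y) - f(x)) / (y - x)` of a polynomial, as a polynomial expression. -/
def divDiff (f : A[X]) (x y : A) : A :=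
  f.sum fun n a => a * ∑ i ∈ Finset.range n, y ^ i * x ^ (n - 1 - i)

lemma divDiff_mul_sub (f : A[X]) (x y : A) :
    divDiff f x y * (y - x) = f.eval y - f.eval x := by
  rw [divDiff, eval_eq_sum, eval_eq_sum, Polynomial.sum, Polynomial.sum, Polynomial.sum,
    Finset.sum_mul, ← Finset.sum_sub_distrib]
  refine Finset.sum_congr rfl fun n _ => ?_
  rw [mul_assoc, (Commute.all y x).geom_sum₂_mul, mul_sub]

lemma divDiff_self (f : A[X]) (x : A) : divDiff f x x = f.derivative.eval x := by
  rw [divDiff, derivative_eval]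
  refine Finset.sum_congr rfl fun n _ => ?_
  simp only [geom_sum₂_self]
  ring

lemma map_divDiff (g : A →+* B) (f : A[X]) (x y : A) :
    g (divDiff f x y) = divDiff (f.map g) (g x) (g y) := by
  rw [divDiff, divDiff, Polynomial.sum_over_range' f (by simp) (f.natDegree + 1) (by simp),
    Polynomial.sum_over_range' (f.map g) (by simp) (f.natDegree + 1)
      (Nat.lt_succ_of_le natDegree_map_le)]
  simp

lemma map_iterate_eval (g : A →+* B) (f : A[X]) (l : ℕ) (x : A) :
    g ((fun z => f.eval z)^[l] x) = (fun z => (f.map g).eval z)^[l] (g x) := by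
  induction l with
  | zero => rfl
  | succ l ih => rw [Function.iterate_succ_apply', Function.iterate_succ_apply', ← ih,
      eval_map_apply]

/-- The quotient `(f^m(x) - x) / (f(x) - x)`, as a polynomial expression in `x`. -/
def cyc (f : A[X]) (m : ℕ) (x : A) : A :=
  ∑ j ∈ Finset.range m, ∏ l ∈ Finset.range j,
    divDiff f ((fun z => f.eval z)^[l] x) ((fun z => f.eval z)^[l + 1] x)

lemma prod_divDiff_mul (f : A[X]) (j : ℕ) (x : A) :
    (∏ l ∈ Finset.range j,
      divDiff f ((fun z => f.eval z)^[l] x) ((fun z => f.eval z)^[l + 1] x)) * (f.eval x - x) =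
    (fun z => f.eval z)^[j + 1] x - (fun z => f.eval z)^[j] x := by
  induction j with
  | zero => simp
  | succ j ih =>
    rw [Finset.prod_range_succ, mul_right_comm, ih, mul_comm, divDiff_mul_sub,
      ← Function.iterate_succ_apply' (fun z => f.eval z),
      ← Function.iterate_succ_apply' (fun z => f.eval z)]

lemma cyc_mul_sub (f : A[X]) (m : ℕ) (x : A) :
    cyc f m x * (f.eval x - x) = (fun z => f.eval z)^[m] x - x := by
  rw [cyc, Finset.sum_mul, Finset.sum_congr rfl fun j _ => prod_divDiff_mul f j x,
    Finset.sum_range_sub (fun j => (fun z => f.eval z)^[j] x)]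
  rfl

lemma cyc_of_fixed (f : A[X]) (m : ℕ) {x : A} (hx : f.eval x = x) :
    cyc f m x = ∑ j ∈ Finset.range m, (f.derivative.eval x) ^ j := by
  refine Finset.sum_congr rfl fun j _ => ?_
  have h : ∀ l, (fun z => f.eval z)^[l] x = x := fun l => Function.iterate_fixed hx l
  simp [h, divDiff_self]

lemma map_cyc (g : A →+* B) (f : A[X]) (m : ℕ) (x : A) :
    g (cyc f m x) = cyc (f.map g) m (g x) := by
  simp only [cyc, map_sum, map_prod, map_divDiff, map_iterate_eval]

lemma sub_dvd_divDiff_sub (f : A[X]) (x y : A) :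
    y - x ∣ divDiff f x y - f.derivative.eval x := by
  rw [← Ideal.mem_span_singleton, ← Ideal.Quotient.eq, ← divDiff_self, map_divDiff, map_divDiff,
    (Ideal.Quotient.eq (x := y) (y := x)).2 (Ideal.mem_span_singleton_self _)]

lemma sub_dvd_cyc_sub (f : A[X]) (m : ℕ) (x y : A) : y - x ∣ cyc f m y - cyc f m x := by
  rw [← Ideal.mem_span_singleton, ← Ideal.Quotient.eq, map_cyc, map_cyc,
    (Ideal.Quotient.eq (x := y) (y := x)).2 (Ideal.mem_span_singleton_self _)]

lemma cyc_eval_mul_divDiff [IsDomain A] (f : A[X]) (m : ℕ) {x : A} (hx : f.eval x ≠ x) :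
    cyc f m (f.eval x) * divDiff f x (f.eval x) =
      cyc f m x * divDiff f x ((fun z => f.eval z)^[m] x) := by
  refine mul_right_cancel₀ (sub_ne_zero.2 hx) ?_
  rw [mul_assoc, divDiff_mul_sub, cyc_mul_sub, mul_right_comm, cyc_mul_sub,
    mul_comm (_ - x), divDiff_mul_sub, ← Function.iterate_succ_apply (fun z => f.eval z),
    Function.iterate_succ_apply' (fun z => f.eval z)]

/-- `cyc f m` as a polynomial. -/
noncomputable def cycPoly (f : A[X]) (m : ℕ) : A[X] := cyc (f.map C) m X

lemma eval₂_cycPoly (g : A →+* B) (f : A[X]) (m : ℕ) (b : B) :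
    (cycPoly f m).eval₂ g b = cyc (f.map g) m b := by
  have h : (f.map C).map (eval₂RingHom g b) = f.map g := by
    rw [Polynomial.map_map]; congr 1; ext; simp
  rw [← coe_eval₂RingHom, cycPoly, map_cyc, h]
  simp

lemma eval_cycPoly (f : A[X]) (m : ℕ) (b : A) : (cycPoly f m).eval b = cyc f m b := by
  rw [eval, eval₂_cycPoly, Polynomial.map_id]

end DividedDifference

section Field

variable {k : Type*} [Field k]

lemma divDiff_ne_zero_of_cyc_eq_zero {f : k[X]} {m : ℕ} (hm : m ≠ 0) {x : k}
    (h : cyc f m x = 0) : divDiff f x (f.eval x) ≠ 0 := by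
  intro hD
  have hper : (fun z => f.eval z)^[m] x = x := by
    have := cyc_mul_sub f m x
    rw [h, zero_mul] at this
    exact (sub_eq_zero.1 this.symm)
  by_cases hx : f.eval x = x
  · rw [hx, divDiff_self] at hD
    rw [cyc_of_fixed f m hx, hD, Finset.sum_eq_single_of_mem 0 (by simp; omega)] at h
    · simp at h
    · intro j _ hj; simp [hj]
  · have h1 : f.eval (f.eval x) = f.eval x := by
      have := divDiff_mul_sub f x (f.eval x)
      rw [hD, zero_mul] at this
      exact (sub_eq_zero.1 this.symm)
    obtain ⟨n, rfl⟩ := Nat.exists_eq_succ_of_ne_zero hm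
    rw [Function.iterate_succ_apply, Function.iterate_fixed h1 n] at hper
    exact hx hper

lemma not_cyc_eq_zero_of_coprime [CharZero k] {f : k[X]} {m m' : ℕ} (hm : m ≠ 0)
    (hmm : m.Coprime m') {x : k} (h : cyc f m x = 0) (h' : cyc f m' x = 0) : False := by
  have hper : ∀ {m}, cyc f m x = 0 → Function.IsPeriodicPt (fun z => f.eval z) m x := by
    intro m h
    have := cyc_mul_sub f m x
    rw [h, zero_mul] at this
    exact (sub_eq_zero.1 this.symm)
  have hx : f.eval x = x := by
    have := (hper h).gcd (hper h')
    rw [hmm.gcd_eq_one] at this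
    exact this
  rw [cyc_of_fixed f _ hx] at h h'
  have hpow : ∀ {m}, ∑ j ∈ Finset.range m, (f.derivative.eval x) ^ j = 0 →
      (f.derivative.eval x) ^ m = 1 := by
    intro m h
    have := geom_sum_mul (f.derivative.eval x) m
    rw [h, zero_mul] at this
    exact (sub_eq_zero.1 this.symm)
  have h1 : f.derivative.eval x = 1 := by
    have := Nat.dvd_gcd (orderOf_dvd_of_pow_eq_one (hpow h)) (orderOf_dvd_of_pow_eq_one (hpow h'))
    rw [hmm.gcd_eq_one, Nat.dvd_one, orderOf_eq_one_iff] at this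
    exact this
  rw [h1] at h
  simp [hm] at h

lemma isCoprime_cycPoly [CharZero k] (f : k[X]) {m m' : ℕ} (hm : m ≠ 0)
    (hmm : m.Coprime m') : IsCoprime (cycPoly f m) (cycPoly f m') := by
  have : CharZero (AlgebraicClosure k) := charZero_of_injective_algebraMap
    (algebraMap k (AlgebraicClosure k)).injective
  rw [Polynomial.isCoprime_iff_aeval_ne_zero_of_isAlgClosed k (AlgebraicClosure k)]
  intro a
  by_contra! h
  rw [aeval_def, aeval_def, eval₂_cycPoly, eval₂_cycPoly] at h
  exact not_cyc_eq_zero_of_coprime hm hmm h.1 h.2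

/-- A nonzero polynomial is coprime to `cycPoly f m` for all but finitely many primes `m`. -/
lemma finite_primes_not_isCoprime_cycPoly [CharZero k] (f : k[X]) {q : k[X]} (hq : q ≠ 0) :
    {m : ℕ | m.Prime ∧ ¬ IsCoprime q (cycPoly f m)}.Finite := by
  have : CharZero (AlgebraicClosure k) := charZero_of_injective_algebraMap
    (algebraMap k (AlgebraicClosure k)).injective
  have key : ∀ m ∈ {m : ℕ | m.Prime ∧ ¬ IsCoprime q (cycPoly f m)},
      ∃ a ∈ q.rootSet (AlgebraicClosure k), aeval a (cycPoly f m) = 0 := by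
    rintro m ⟨-, h⟩
    rw [Polynomial.isCoprime_iff_aeval_ne_zero_of_isAlgClosed k (AlgebraicClosure k)] at h
    push Not at h
    obtain ⟨a, h1, h2⟩ := h
    exact ⟨a, (mem_rootSet_of_ne hq).2 h1, h2⟩
  choose! r hr hr' using key
  refine Set.Finite.of_injOn (f := r) (t := q.rootSet (AlgebraicClosure k)) hr ?_
    (q.rootSet_finite _)
  intro m hm m' hm' hmm
  by_contra hne
  have h1 := hr' m hm
  have h2 := hr' m' hm'
  rw [← hmm] at h2
  rw [aeval_def, eval₂_cycPoly] at h1 h2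
  exact not_cyc_eq_zero_of_coprime hm.1.ne_zero ((Nat.coprime_primes hm.1 hm'.1).2 hne) h1 h2

lemma cycPoly_mul_sub (f : k[X]) (m : ℕ) :
    cycPoly f m * (f - X) = f.comp^[m] X - X := by
  have h := cyc_mul_sub (f.map C) m (X : k[X])
  have h1 : ∀ p : k[X], (f.map C).eval p = f.comp p := fun p => by
    rw [eval_map]; rfl
  have h2 : (fun z => (f.map C).eval z) = f.comp := funext h1
  rw [h1, comp_X, h2] at h
  exact h

lemma natDegree_cycPoly_pos {f : k[X]} (hf : 2 ≤ f.natDegree) {m : ℕ} (hm : 2 ≤ m) :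
    1 ≤ (cycPoly f m).natDegree := by
  have h := cycPoly_mul_sub f m
  have hX : (f - X).natDegree = f.natDegree := by
    rw [natDegree_sub_eq_left_of_natDegree_lt]; rw [natDegree_X]; omega
  have hd : (f.comp^[m] X).natDegree = f.natDegree ^ m := by
    rw [natDegree_iterate_comp, natDegree_X, mul_one]
  have hlt : f.natDegree < f.natDegree ^ m := lt_self_pow₀ (by omega) (by omega)
  have hR : (f.comp^[m] X - X).natDegree = f.natDegree ^ m := by
    rw [natDegree_sub_eq_left_of_natDegree_lt, hd]; rw [natDegree_X, hd]; omega
  rw [← h] at hR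
  have := natDegree_mul_le (p := cycPoly f m) (q := f - X)
  omega

end Field

section Growth

variable {K : Type*} [Field K] (v : AbsoluteValue K ℝ)

lemma exists_abv_eval_le (p : K[X]) {n : ℕ} (hn : p.natDegree ≤ n) :
    ∃ c ≥ 1, ∀ x, v (p.eval x) ≤ c * max 1 (v x) ^ n := by
  refine ⟨1 + ∑ i ∈ Finset.range (n + 1), v (p.coeff i), ?_, fun x => ?_⟩
  · have := Finset.sum_nonneg fun i (_ : i ∈ Finset.range (n + 1)) => v.nonneg (p.coeff i)
    linarith
  · rw [eval_eq_sum_range' (Nat.lt_succ_of_le hn)]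
    refine (v.sum_le _ _).trans ?_
    have h1 : (1 : ℝ) ≤ max 1 (v x) := le_max_left _ _
    have : ∑ i ∈ Finset.range (n + 1), v (p.coeff i * x ^ i) ≤
        (∑ i ∈ Finset.range (n + 1), v (p.coeff i)) * max 1 (v x) ^ n := by
      rw [Finset.sum_mul]
      refine Finset.sum_le_sum fun i hi => ?_
      rw [map_mul, map_pow]
      refine mul_le_mul_of_nonneg_left ?_ (v.nonneg _)
      exact (pow_le_pow_left₀ (v.nonneg x) (le_max_right 1 (v x)) i).trans
        (pow_le_pow_right₀ h1 (Nat.lt_succ_iff.1 (Finset.mem_range.1 hi)))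
    have h0 : 0 ≤ max 1 (v x) ^ n := by positivity
    linarith

/-- Lower growth bound for a polynomial away from a bounded set. -/
lemma exists_le_abv_eval (p : K[X]) (hp : 1 ≤ p.natDegree) :
    ∃ c > 0, ∃ B ≥ 1, ∀ x, B < v x → c * v x ^ p.natDegree ≤ v (p.eval x) := by
  obtain ⟨c, hc, h⟩ := exists_abv_eval_le v p.eraseLead (eraseLead_natDegree_le p)
  have hl : 0 < v p.leadingCoeff := v.pos (leadingCoeff_ne_zero.2 (by rintro rfl; simp at hp))
  refine ⟨v p.leadingCoeff / 2, by positivity, max 1 (2 * c / v p.leadingCoeff),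
    le_max_left _ _, fun x hx => ?_⟩
  obtain ⟨h1, h2⟩ := max_lt_iff.1 hx
  have h3 := h x
  rw [max_eq_right h1.le] at h3
  have h4 : p.eval x = p.leadingCoeff * x ^ p.natDegree + p.eraseLead.eval x := by
    have := congrArg (eval x) p.eraseLead_add_C_mul_X_pow
    simp only [eval_add, eval_mul, eval_C, eval_pow, eval_X] at this
    linear_combination -this
  have h5 : v (p.leadingCoeff * x ^ p.natDegree) ≤ v (p.eval x) + v (p.eraseLead.eval x) := by
    have := v.add_le (p.eval x) (-(p.eraseLead.eval x))
    rwa [v.map_neg, ← sub_eq_add_neg, sub_eq_of_eq_add h4] at this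
  rw [map_mul, map_pow] at h5
  obtain ⟨n, hn⟩ := Nat.exists_eq_add_of_le hp
  rw [hn] at h5 h3 ⊢
  rw [add_tsub_cancel_left] at h3
  rw [div_lt_iff₀ hl] at h2
  have h6 : 0 < v x ^ n := by positivity
  rw [add_comm 1 n, pow_succ] at h5 ⊢
  nlinarith [mul_lt_mul_of_pos_right h2 h6]

/-- If `deg h < deg G`, then `G / h` is bounded below by a multiple of `max(1, |x|)`, away from
the points where `G` is small. -/
lemma exists_mul_abv_eval_le (h G : K[X]) (hG : h.natDegree < G.natDegree) :
    ∃ B ≥ 1, ∀ δ > 0, ∃ c > 0, ∀ x, (v x ≤ B ∧ v (G.eval x) < δ) ∨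
      c * max 1 (v x) * v (h.eval x) ≤ v (G.eval x) := by
  obtain ⟨c₁, hc₁, h₁⟩ := exists_abv_eval_le v h le_rfl
  obtain ⟨c₂, hc₂, B, hB, h₂⟩ := exists_le_abv_eval v G (by omega)
  refine ⟨B, hB, fun δ hδ => ?_⟩
  have hB' : 0 < B := by linarith
  have hc₁' : 0 < c₁ := by linarith
  refine ⟨min (c₂ / c₁) (δ / (B * (c₁ * B ^ h.natDegree))), by positivity, fun x => ?_⟩
  rcases le_or_gt (v x) B with hx | hx
  · refine or_iff_not_imp_left.2 fun hlt => ?_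
    simp only [hx, true_and, not_lt] at hlt
    refine le_trans ?_ hlt
    have hm : max 1 (v x) ≤ B := max_le hB hx
    have := h₁ x
    calc _ ≤ δ / (B * (c₁ * B ^ h.natDegree)) * B * (c₁ * B ^ h.natDegree) := by
          gcongr
          · exact min_le_right _ _
          · refine this.trans ?_
            gcongr
      _ = δ := by field_simp
  · right
    have h1x : 1 < v x := by linarith
    have h3 := h₁ x
    rw [max_eq_right h1x.le] at h3 ⊢
    calc _ ≤ c₂ / c₁ * v x * (c₁ * v x ^ h.natDegree) := by
          gcongr
          exact min_le_left _ _
      _ = c₂ * v x ^ (h.natDegree + 1) := by field_simp; ring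
      _ ≤ c₂ * v x ^ G.natDegree := by
          gcongr
          · exact h1x.le
          · omega
      _ ≤ _ := h₂ x hx

end Growth

section Local

variable {K : Type*} [Field K]

/-- The valuation ring of a nonarchimedean absolute value. -/
def absInt (v : AbsoluteValue K ℝ) (hv : ∀ x y, v (x + y) ≤ max (v x) (v y)) :
    ValuationSubring K where
  carrier := {x | v x ≤ 1}
  mul_mem' {a b} ha hb := by
    simp only [Set.mem_ofPred_eq, map_mul] at *
    exact mul_le_one₀ ha (v.nonneg b) hb
  one_mem' := by simp
  add_mem' {a b} ha hb := (hv a b).trans (max_le ha hb)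
  zero_mem' := by simp
  neg_mem' {a} ha := by simpa using ha
  mem_or_inv_mem' x := by
    simp only [Set.mem_ofPred_eq, map_inv₀]
    rcases le_total (v x) 1 with h | h
    · exact Or.inl h
    · exact Or.inr (inv_le_one_of_one_le₀ h)

variable {v : AbsoluteValue K ℝ} (hv : ∀ x y, v (x + y) ≤ max (v x) (v y))

lemma mem_absInt {x : K} : x ∈ absInt v hv ↔ v x ≤ 1 := Iff.rfl

lemma mem_maximalIdeal_absInt (a : absInt v hv) :
    a ∈ IsLocalRing.maximalIdeal (absInt v hv) ↔ v (a : K) < 1 := by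
  have ha : v (a : K) ≤ 1 := a.2
  rw [IsLocalRing.mem_maximalIdeal, mem_nonunits_iff]
  constructor
  · intro h
    refine ha.lt_of_ne fun h1 => h ?_
    have h0 : (a : K) ≠ 0 := by rintro h0; simp [h0] at h1
    exact IsUnit.of_mul_eq_one ⟨(a : K)⁻¹, by rw [mem_absInt, map_inv₀, h1, inv_one]⟩
      (Subtype.ext (mul_inv_cancel₀ h0))
  · rintro h ⟨u, rfl⟩
    have h1 := congrArg (fun b : absInt v hv => v (b : K)) u.mul_inv
    have h2 : v ((↑u⁻¹ : absInt v hv) : K) ≤ 1 := (↑u⁻¹ : absInt v hv).2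
    simp only [MulMemClass.coe_mul, map_mul, OneMemClass.coe_one, map_one] at h1
    nlinarith [v.nonneg ((u : absInt v hv) : K)]

include hv in
lemma abv_sub_le_max (x y : K) : v (x - y) ≤ max (v x) (v y) := by
  simpa [sub_eq_add_neg] using hv x (-y)

lemma exists_lift_absInt {f : K[X]} (hf : ∀ n, v (f.coeff n) ≤ 1) :
    ∃ f₀ : (absInt v hv)[X], f₀.map (absInt v hv).subtype = f := by
  have : f ∈ lifts (absInt v hv).subtype := by
    rw [lifts_iff_coeff_lifts]
    exact fun n => ⟨⟨f.coeff n, hf n⟩, rfl⟩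
  exact this

lemma abv_le_of_dvd {a b : absInt v hv} (h : a ∣ b) : v (b : K) ≤ v (a : K) := by
  obtain ⟨c, rfl⟩ := h
  simpa using mul_le_of_le_one_right (v.nonneg (a : K)) c.2

variable {f : K[X]} (hf : ∀ n, v (f.coeff n) ≤ 1)

include hv hf

lemma abv_eval_le_one {x : K} (hx : v x ≤ 1) : v (f.eval x) ≤ 1 := by
  obtain ⟨f, rfl⟩ := exists_lift_absInt hv hf
  have := eval_map_apply (p := f) (absInt v hv).subtype ⟨x, hx⟩
  exact this ▸ (f.eval (⟨x, hx⟩ : absInt v hv)).2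

lemma abv_iterate_le_one {x : K} (hx : v x ≤ 1) (k : ℕ) : v ((fun z => f.eval z)^[k] x) ≤ 1 := by
  induction k with
  | zero => exact hx
  | succ k ih => rw [Function.iterate_succ_apply']; exact abv_eval_le_one hv hf ih

lemma abv_divDiff_le_one {x y : K} (hx : v x ≤ 1) (hy : v y ≤ 1) : v (divDiff f x y) ≤ 1 := by
  obtain ⟨f, rfl⟩ := exists_lift_absInt hv hf
  have := map_divDiff (absInt v hv).subtype f ⟨x, hx⟩ ⟨y, hy⟩
  exact this ▸ (divDiff f (⟨x, hx⟩ : absInt v hv) ⟨y, hy⟩).2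

lemma abv_cyc_le_one (m : ℕ) {x : K} (hx : v x ≤ 1) : v (cyc f m x) ≤ 1 := by
  obtain ⟨f, rfl⟩ := exists_lift_absInt hv hf
  have := map_cyc (absInt v hv).subtype f m ⟨x, hx⟩
  exact this ▸ (cyc f m (⟨x, hx⟩ : absInt v hv)).2

lemma abv_cyc_sub_le (m : ℕ) {x y : K} (hx : v x ≤ 1) (hy : v y ≤ 1) :
    v (cyc f m y - cyc f m x) ≤ v (y - x) := by
  obtain ⟨f, rfl⟩ := exists_lift_absInt hv hf
  have h1 := map_cyc (absInt v hv).subtype f m ⟨x, hx⟩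
  have h2 := map_cyc (absInt v hv).subtype f m ⟨y, hy⟩
  have h3 := abv_le_of_dvd hv (sub_dvd_cyc_sub f m (⟨x, hx⟩ : absInt v hv) ⟨y, hy⟩)
  change v ((absInt v hv).subtype _ - (absInt v hv).subtype _) ≤ _ at h3
  rwa [h1, h2] at h3

lemma abv_divDiff_sub_le {x y : K} (hx : v x ≤ 1) (hy : v y ≤ 1) :
    v (divDiff f x y - f.derivative.eval x) ≤ v (y - x) := by
  obtain ⟨f, rfl⟩ := exists_lift_absInt hv hf
  have h1 := map_divDiff (absInt v hv).subtype f ⟨x, hx⟩ ⟨y, hy⟩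
  have h2 := map_divDiff (absInt v hv).subtype f ⟨x, hx⟩ ⟨x, hx⟩
  have h3 := abv_le_of_dvd hv (sub_dvd_divDiff_sub f (⟨x, hx⟩ : absInt v hv) ⟨y, hy⟩)
  rw [← divDiff_self] at h3 ⊢
  change v ((absInt v hv).subtype _ - (absInt v hv).subtype _) ≤ _ at h3
  rwa [h1, h2] at h3

lemma abv_divDiff_eq_one {m : ℕ} (hm : m ≠ 0) {x : K} (hx : v x ≤ 1) (h : v (cyc f m x) < 1) :
    v (divDiff f x (f.eval x)) = 1 := by
  refine le_antisymm (abv_divDiff_le_one hv hf hx (abv_eval_le_one hv hf hx))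
    (not_lt.1 fun hlt => ?_)
  obtain ⟨f, rfl⟩ := exists_lift_absInt hv hf
  lift x to absInt v hv using hx
  have hr : ∀ a : absInt v hv, IsLocalRing.residue (absInt v hv) a = 0 ↔ v (a : K) < 1 :=
      fun a => by
    rw [IsLocalRing.residue_eq_zero_iff, mem_maximalIdeal_absInt]
  have h1 := map_cyc (absInt v hv).subtype f m x
  have h2 : (f.map (absInt v hv).subtype).eval (x : K) = (f.eval x : absInt v hv) := by
    exact eval_map_apply (absInt v hv).subtype x
  have h3 := map_divDiff (absInt v hv).subtype f x (f.eval x)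
  rw [h2] at hlt
  have h4 := (hr (cyc f m x)).2 (by change v ((absInt v hv).subtype _) < 1; rw [h1]; exact h)
  have h5 := (hr (divDiff f x (f.eval x))).2
    (by change v ((absInt v hv).subtype _) < 1; rw [h3]; exact hlt)
  rw [map_cyc] at h4
  rw [map_divDiff, ← eval_map_apply] at h5
  exact divDiff_ne_zero_of_cyc_eq_zero hm h4 h5

lemma abv_cyc_eval {m : ℕ} (hm : m ≠ 0) {x : K} (hx : v x ≤ 1) (hne : f.eval x ≠ x)
    (h : v (cyc f m x) < 1) :
    v (cyc f m (f.eval x)) = v (cyc f m x) * v (divDiff f x ((fun z => f.eval z)^[m] x)) := by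
  have := congrArg v (cyc_eval_mul_divDiff f m hne)
  rwa [map_mul, map_mul, abv_divDiff_eq_one hv hf hm hx h, mul_one] at this

lemma abv_cyc_eval_le {m : ℕ} (hm : m ≠ 0) {x : K} (hx : v x ≤ 1) (hne : f.eval x ≠ x)
    (h : v (cyc f m x) < 1) :
    v (cyc f m (f.eval x)) ≤ v (cyc f m x) := by
  rw [abv_cyc_eval hv hf hm hx hne h]
  exact mul_le_of_le_one_right (v.nonneg _)
    (abv_divDiff_le_one hv hf hx (abv_iterate_le_one hv hf hx m))

lemma abv_cyc_iterate_le {m : ℕ} (hm : m ≠ 0) {x : K} (hx : v x ≤ 1)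
    (hne : ∀ k, (fun z => f.eval z)^[k + 1] x ≠ (fun z => f.eval z)^[k] x)
    {k : ℕ} (h : v (cyc f m ((fun z => f.eval z)^[k] x)) < 1) {l : ℕ} (hl : k ≤ l) :
    v (cyc f m ((fun z => f.eval z)^[l] x)) ≤ v (cyc f m ((fun z => f.eval z)^[k] x)) := by
  induction l, hl using Nat.le_induction with
  | base => exact le_rfl
  | succ l _ ih =>
    have hne' := hne l
    rw [Function.iterate_succ_apply'] at hne' ⊢
    exact (abv_cyc_eval_le hv hf hm (abv_iterate_le_one hv hf hx l) hne' (ih.trans_lt h)).trans ih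

/-- If the orbit falls into the residue class of a root of `cyc f m`, then `cyc f m` decreases at
most geometrically along the orbit, provided that no critical point is a root of `cyc f m`. -/
lemma exists_eventually_mul_abv_cyc_le {m : ℕ} (hm : m ≠ 0)
    (hcop : IsCoprime f.derivative (cycPoly f m)) {x : K} (hx : v x ≤ 1)
    (hne : ∀ k, (fun z => f.eval z)^[k + 1] x ≠ (fun z => f.eval z)^[k] x)
    {k₀ : ℕ} (h : v (cyc f m ((fun z => f.eval z)^[k₀] x)) < 1) :
    ∃ η > 0, ∃ k₁, ∀ k ≥ k₁, η * v (cyc f m ((fun z => f.eval z)^[k] x)) ≤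
      v (cyc f m ((fun z => f.eval z)^[k + 1] x)) := by
  have horb := abv_iterate_le_one hv hf hx
  obtain ⟨A, B, hAB⟩ := hcop
  obtain ⟨CA, hCA, hA⟩ := exists_abv_eval_le v A le_rfl
  obtain ⟨CB, hCB, hB⟩ := exists_abv_eval_le v B le_rfl
  set c := max CA CB with hc
  have hc0 : 0 < c := lt_max_of_lt_left (by linarith)
  set η := 1 / (2 * c) with hη
  have hη0 : 0 < η := by positivity
  refine ⟨η, hη0, ?_⟩
  by_cases hex : ∃ k ≥ k₀, v (cyc f m ((fun z => f.eval z)^[k] x)) < η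
  · obtain ⟨k₁, hk₁, hlt⟩ := hex
    refine ⟨k₁, fun k hk => ?_⟩
    have hlt1 := (abv_cyc_iterate_le hv hf hm hx hne h hk₁).trans_lt h
    have hltk := (abv_cyc_iterate_le hv hf hm hx hne hlt1 hk).trans_lt hlt
    have hltk1 := (abv_cyc_iterate_le hv hf hm hx hne hlt1 hk).trans_lt hlt1
    have hnek := hne k
    rw [Function.iterate_succ_apply'] at hnek ⊢
    have hxk := horb k
    set y := (fun z => f.eval z)^[k] x
    rw [abv_cyc_eval hv hf hm hxk hnek hltk1, mul_comm]
    refine mul_le_mul_of_nonneg_left ?_ (v.nonneg _)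
    by_contra! hD
    have hym := abv_iterate_le_one hv hf hxk m
    have h1 : v ((fun z => f.eval z)^[m] y - y) < η := by
      rw [← cyc_mul_sub, map_mul]
      refine (mul_le_of_le_one_right (v.nonneg _) ?_).trans_lt hltk
      exact (abv_sub_le_max hv _ _).trans (max_le (abv_eval_le_one hv hf hxk) hxk)
    have h2 := (abv_divDiff_sub_le hv hf hxk hym).trans_lt h1
    have h3 : v (f.derivative.eval y) < η := by
      have := abv_sub_le_max hv (divDiff f y ((fun z => f.eval z)^[m] y))
        (divDiff f y ((fun z => f.eval z)^[m] y) - f.derivative.eval y)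
      rw [sub_sub_cancel] at this
      exact this.trans_lt (max_lt hD h2)
    have h4 := congrArg (fun p => v (p.eval y)) hAB
    simp only [eval_add, eval_mul, eval_cycPoly, eval_one, map_one] at h4
    have hA' := hA y
    have hB' := hB y
    rw [max_eq_left hxk, one_pow, mul_one] at hA' hB'
    have h5 := hv (A.eval y * f.derivative.eval y) (B.eval y * cyc f m y)
    rw [h4, map_mul, map_mul] at h5
    have h6 : c * η = 1 / 2 := by rw [hη]; field_simp
    have h7 : v (A.eval y) * v (f.derivative.eval y) ≤ c * η :=
      mul_le_mul (hA'.trans (le_max_left _ _)) h3.le (v.nonneg _) hc0.le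
    have h8 : v (B.eval y) * v (cyc f m y) ≤ c * η :=
      mul_le_mul (hB'.trans (le_max_right _ _)) hltk.le (v.nonneg _) hc0.le
    have := h5.trans (max_le h7 h8)
    linarith
  · push Not at hex
    refine ⟨k₀, fun k hk => ?_⟩
    exact (mul_le_of_le_one_right hη0.le (abv_cyc_le_one hv hf m (horb k))).trans
      (hex (k + 1) (by omega))

end Local

section Local

variable {K : Type} [Field K] {v : AbsoluteValue K ℝ}

/-- At the absolute value `v` the polynomial `f` and the point `x` are integral, and, over every
nonarchimedean extension, the orbit of `x` under `f` meets the residue class of an integral root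
of `q` only finitely often. -/
def OrbitAvoidsRoots (v : AbsoluteValue K ℝ) (f q : K[X]) (x : K) : Prop :=
  (∀ n, v (f.coeff n) ≤ 1) ∧ v x ≤ 1 ∧
    ∀ (L : Type) [Field L] (emb : K →+* L) (w : AbsoluteValue L ℝ),
      (∀ a b, w (a + b) ≤ max (w a) (w b)) → (∀ a, w (emb a) = v a) →
      ∀ b, w b ≤ 1 → (q.map emb).eval b = 0 →
        {k : ℕ | w (b - emb ((fun z => f.eval z)^[k] x)) < 1}.Finite

/-- If the orbit meets the residue class of a root of `q` infinitely often, then it is eventually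
periodic modulo `v`, and it avoids the residue classes of the roots of every `cyc f m` for which
`cycPoly f m` and `q` are coprime with integral Bézout coefficients. -/
lemma eventually_periodic_and_abv_cyc_eq_one (hv : ∀ x y, v (x + y) ≤ max (v x) (v y))
    {f q : K[X]} {x : K} (hf : ∀ n, v (f.coeff n) ≤ 1) (hx : v x ≤ 1)
    (hne : ∀ k, (fun z => f.eval z)^[k + 1] x ≠ (fun z => f.eval z)^[k] x)
    (h : ¬ OrbitAvoidsRoots v f q x) :
    (∃ N ≥ 1, ∃ k₀, ∀ k ≥ k₀, ∀ j,
      v ((fun z => f.eval z)^[k + j * N] x - (fun z => f.eval z)^[k] x) < 1) ∧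
    ∀ m ≠ 0, ∀ A B : K[X], A * q + B * cycPoly f m = 1 → (∀ n, v (B.coeff n) ≤ 1) →
      ∀ k, v (cyc f m ((fun z => f.eval z)^[k] x)) = 1 := by
  have horb := abv_iterate_le_one hv hf hx
  simp only [OrbitAvoidsRoots, hf, hx, not_forall, implies_true, true_and,
    exists_prop] at h
  obtain ⟨L, _, emb, w, hw, hwv, b, hb, hq, hinf⟩ := h
  have hwf : ∀ n, w ((f.map emb).coeff n) ≤ 1 := fun n => by rw [coeff_map, hwv]; exact hf n
  constructor
  · obtain ⟨k, hk, l, hl, hkl⟩ : ∃ k, w (b - emb ((fun z => f.eval z)^[k] x)) < 1 ∧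
        ∃ l, w (b - emb ((fun z => f.eval z)^[l] x)) < 1 ∧ k < l := by
      obtain ⟨k, hk⟩ := Set.Infinite.nonempty hinf
      obtain ⟨l, hl, hkl⟩ := Set.Infinite.exists_gt hinf k
      exact ⟨k, hk, l, hl, hkl⟩
    have hkl' : v ((fun z => f.eval z)^[l] x - (fun z => f.eval z)^[k] x) < 1 := by
      rw [← hwv, map_sub, ← sub_sub_sub_cancel_left _ _ b]
      exact (abv_sub_le_max hw _ _).trans_lt (max_lt hk hl)
    obtain ⟨N, rfl⟩ := Nat.exists_eq_add_of_lt hkl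
    have step : ∀ k' ≥ k, v ((fun z => f.eval z)^[k' + (N + 1)] x -
        (fun z => f.eval z)^[k'] x) < 1 := by
      intro k' hk'
      induction k', hk' using Nat.le_induction with
      | base => exact hkl'
      | succ k' _ ih =>
        rw [add_right_comm, Function.iterate_succ_apply', Function.iterate_succ_apply',
          ← divDiff_mul_sub, map_mul]
        exact (mul_le_of_le_one_left (v.nonneg _)
          (abv_divDiff_le_one hv hf (horb _) (horb _))).trans_lt ih
    refine ⟨N + 1, by omega, k, fun k' hk' j => ?_⟩
    induction j with
    | zero => simp
    | succ j ih =>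
      rw [← sub_add_sub_cancel _ ((fun z => f.eval z)^[k' + j * (N + 1)] x)]
      refine (hv _ _).trans_lt (max_lt ?_ ih)
      rw [add_mul, one_mul, ← add_assoc]
      exact step _ (by omega)
  · intro m hm A B hAB hB k
    refine le_antisymm (abv_cyc_le_one hv hf m (horb k)) (not_lt.1 fun hlt => ?_)
    obtain ⟨l, hl, hkl⟩ := Set.Infinite.exists_gt hinf k
    have h1 := (abv_cyc_iterate_le hv hf hm hx hne hlt hkl.le).trans_lt hlt
    have hl' : w (b - emb ((fun z => f.eval z)^[l] x)) < 1 := hl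
    have h2 := abv_cyc_sub_le hw hwf m (x := emb ((fun z => f.eval z)^[l] x)) (y := b)
      (by rw [hwv]; exact horb l) hb
    have h3 : w (cyc (f.map emb) m b) < 1 := by
      have := hw (cyc (f.map emb) m b - cyc (f.map emb) m (emb ((fun z => f.eval z)^[l] x)))
        (cyc (f.map emb) m (emb ((fun z => f.eval z)^[l] x)))
      rw [sub_add_cancel, ← map_cyc, hwv, map_cyc] at this
      exact this.trans_lt (max_lt (h2.trans_lt hl') h1)
    have h4 := congrArg (fun p => w (p.eval₂ emb b)) hAB
    simp only [eval₂_add, eval₂_mul, eval₂_cycPoly, eval₂_one, map_one] at h4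
    rw [← eval_map emb (p := q), hq, mul_zero, zero_add, ← eval_map, map_mul] at h4
    have h5 := abv_eval_le_one hw (f := B.map emb)
      (fun n => by rw [coeff_map, hwv]; exact hB n) hb
    have := mul_le_of_le_one_left (w.nonneg (cyc (f.map emb) m b)) h5
    linarith

end Local

section Growth

variable {K : Type*} [Field K] (v : AbsoluteValue K ℝ)

lemma exists_le_abv_eval_or_of_isCoprime {G G' : K[X]} (hG : IsCoprime G G') {B : ℝ}
    (hB : 1 ≤ B) :
    ∃ δ > 0, ∀ x, v x ≤ B → δ ≤ v (G.eval x) ∨ δ ≤ v (G'.eval x) := by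
  obtain ⟨A, A', h⟩ := hG
  obtain ⟨c, hc, hA⟩ := exists_abv_eval_le v A le_rfl
  obtain ⟨c', hc', hA'⟩ := exists_abv_eval_le v A' le_rfl
  have key : ∀ p : K[X], ∀ c ≥ 1, (∀ x, v (p.eval x) ≤ c * max 1 (v x) ^ p.natDegree) →
      ∀ x, v x ≤ B → v (p.eval x) ≤ c * B ^ p.natDegree := fun p c hc h x hx =>
    (h x).trans (by gcongr; exact max_le hB hx)
  set D := c * B ^ A.natDegree + c' * B ^ A'.natDegree
  have hD : 0 < D := by positivity
  refine ⟨1 / D, by positivity, fun x hx => ?_⟩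
  by_contra! hlt
  have h1 := congrArg (fun p => v (p.eval x)) h
  simp only [eval_add, eval_mul, eval_one, map_one] at h1
  have h2 := v.add_le (A.eval x * G.eval x) (A'.eval x * G'.eval x)
  rw [h1, map_mul, map_mul] at h2
  have h3 : v (A.eval x) * v (G.eval x) < c * B ^ A.natDegree * (1 / D) :=
    mul_lt_mul' (key A c hc hA x hx) hlt.1 (v.nonneg _) (by positivity)
  have h4 : v (A'.eval x) * v (G'.eval x) < c' * B ^ A'.natDegree * (1 / D) :=
    mul_lt_mul' (key A' c' hc' hA' x hx) hlt.2 (v.nonneg _) (by positivity)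
  have h5 : D * (1 / D) = 1 := by field_simp
  have h6 : D * (1 / D) = c * B ^ A.natDegree * (1 / D) + c' * B ^ A'.natDegree * (1 / D) := by
    rw [← add_mul]
  linarith

lemma exists_mul_abv_eval_le_or_of_isCoprime {h G h' G' : K[X]}
    (hG : h.natDegree < G.natDegree) (hG' : h'.natDegree < G'.natDegree) (hc : IsCoprime G G') :
    ∃ c > 0, ∀ x, c * max 1 (v x) * v (h.eval x) ≤ v (G.eval x) ∨
      c * max 1 (v x) * v (h'.eval x) ≤ v (G'.eval x) := by
  obtain ⟨B, hB, H⟩ := exists_mul_abv_eval_le v h G hG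
  obtain ⟨B', -, H'⟩ := exists_mul_abv_eval_le v h' G' hG'
  obtain ⟨δ, hδ, hδ'⟩ := exists_le_abv_eval_or_of_isCoprime v hc (hB.trans (le_max_left B B'))
  obtain ⟨c, hc, H⟩ := H δ hδ
  obtain ⟨c', hc', H'⟩ := H' δ hδ
  refine ⟨min c c', lt_min hc hc', fun x => ?_⟩
  have e : ∀ t : ℝ, 0 ≤ t → min c c' * max 1 (v x) * t ≤ c * max 1 (v x) * t := fun t ht => by
    gcongr; exact min_le_left _ _
  have e' : ∀ t : ℝ, 0 ≤ t → min c c' * max 1 (v x) * t ≤ c' * max 1 (v x) * t := fun t ht => by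
    gcongr; exact min_le_right _ _
  rcases H x with h1 | h1
  · rcases H' x with h2 | h2
    · rcases hδ' x (h1.1.trans (le_max_left _ _)) with h | h
      · exact absurd h1.2 (not_lt.2 h)
      · exact absurd h2.2 (not_lt.2 h)
    · exact Or.inr ((e' _ (v.nonneg _)).trans h2)
  · exact Or.inl ((e _ (v.nonneg _)).trans h1)

end Growth

lemma exists_pos_le_of_finset {α : Type*} (T : Finset α) (c : α → ℝ) (hc : ∀ t ∈ T, 0 < c t) :
    ∃ c₀ > 0, ∀ t ∈ T, c₀ ≤ c t := by
  rcases T.eq_empty_or_nonempty with rfl | hT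
  · exact ⟨1, one_pos, by simp⟩
  · obtain ⟨t₀, ht₀, h⟩ := T.exists_min_image c hT
    exact ⟨c t₀, hc t₀ ht₀, h⟩

/-- A family of absolute values of `K`, all but finitely many of them nonarchimedean, discrete and
trivial on the field of constants, that satisfies the product formula. -/
structure ProductFormulaPlaces (K : Type) [Field K] (κ : Subfield K) where
  ι : Type
  v : ι → AbsoluteValue K ℝ
  /-- The nonarchimedean indices. -/
  N : Set ι
  finite_compl : Nᶜ.Finite
  infinite : N.Infinite
  nonarch : ∀ i ∈ N, ∀ x y, v i (x + y) ≤ max (v i x) (v i y)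
  trivial_on_constants : NumberField K ∨ ∀ i ∈ N, ∀ c ∈ κ, c ≠ 0 → v i c = 1
  separating : ∀ i ∈ N, ∀ j ∈ N, i ≠ j → ∃ x, v i x < 1 ∧ ¬ v j x < 1
  discrete : ∀ i ∈ N, ∀ x, v i x < 1 → v i x ≤ 1 / 2
  finite_support : ∀ x ≠ 0, {i | v i x ≠ 1}.Finite
  finprod_eq_one : ∀ x ≠ 0, ∏ᶠ i, v i x = 1

namespace ProductFormulaPlaces

variable {K : Type} [Field K] {κ : Subfield K} (W : ProductFormulaPlaces K κ)

lemma prod_eq_one {x : K} (hx : x ≠ 0) {T : Finset W.ι} (hT : ∀ i ∉ T, W.v i x = 1) :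
    ∏ i ∈ T, W.v i x = 1 := by
  rw [← W.finprod_eq_one x hx]
  refine (finprod_eq_prod_of_mulSupport_subset _ fun i hi => ?_).symm
  by_contra h
  exact hi (hT i h)

lemma one_le_prod {x : K} (hx : x ≠ 0) {T : Finset W.ι} (hT : ∀ i ∉ T, W.v i x ≤ 1) :
    1 ≤ ∏ i ∈ T, W.v i x := by
  classical
  have h1 := W.prod_eq_one hx (T := T ∪ (W.finite_support x hx).toFinset) (by
    intro i hi
    by_contra h
    exact hi (by simp [h]))
  rw [← Finset.prod_sdiff Finset.subset_union_left] at h1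
  rw [← h1]
  refine mul_le_of_le_one_left (Finset.prod_nonneg fun i _ => (W.v i).nonneg x)
    (Finset.prod_le_one (fun i _ => (W.v i).nonneg x) fun i hi => hT i (Finset.mem_sdiff.1 hi).2)

lemma finite_not_integral (x : K) : {i | ¬ W.v i x ≤ 1}.Finite := by
  rcases eq_or_ne x 0 with rfl | hx
  · simp
  · exact (W.finite_support x hx).subset fun i hi h => hi h.le

lemma finite_exists_coeff_not_integral (p : K[X]) :
    {i | ¬ ∀ n, W.v i (p.coeff n) ≤ 1}.Finite := by
  refine (p.support.finite_toSet.biUnion fun n _ => W.finite_not_integral (p.coeff n)).subset ?_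
  intro i hi
  simp only [Set.mem_ofPred_eq, not_forall] at hi
  obtain ⟨n, hn⟩ := hi
  refine Set.mem_biUnion (x := n) ?_ hn
  rw [Finset.mem_coe, mem_support_iff]
  intro h
  simp [h] at hn

section

variable {W} {f q : K[X]} {x : K} {S : Finset W.ι} (hS : ∀ i ∉ S, i ∈ W.N ∧
  (∀ n, W.v i (f.coeff n) ≤ 1) ∧ W.v i x ≤ 1 ∧ ¬ OrbitAvoidsRoots (W.v i) f q x)

include hS

lemma exists_prod_abv_cyc_le
    (hinj : Function.Injective fun k : ℕ => (fun z => f.eval z)^[k] x)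
    {m : ℕ} (hm : m ≠ 0) (hcop : IsCoprime (q * f.derivative) (cycPoly f m)) :
    ∃ C > 0, ∃ k₀, ∀ k ≥ k₀, ∏ i ∈ S, W.v i (cyc f m ((fun z => f.eval z)^[k + 1] x)) ≤
      C * ∏ i ∈ S, W.v i (cyc f m ((fun z => f.eval z)^[k] x)) := by
  classical
  have hne : ∀ k, (fun z => f.eval z)^[k + 1] x ≠ (fun z => f.eval z)^[k] x := fun k h => by
    have := hinj h; omega
  have hc : ∀ k, cyc f m ((fun z => f.eval z)^[k] x) ≠ 0 := fun k h => by
    have := cyc_mul_sub f m ((fun z => f.eval z)^[k] x)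
    rw [h, zero_mul, ← Function.iterate_add_apply, eq_comm, sub_eq_zero] at this
    have := hinj this
    omega
  obtain ⟨A, B, hAB⟩ := hcop.of_mul_left_left
  have hE := W.finite_exists_coeff_not_integral B
  set E := hE.toFinset \ S with hEdef
  have hout : ∀ k, ∀ i ∉ S ∪ E, W.v i (cyc f m ((fun z => f.eval z)^[k] x)) = 1 := by
    intro k i hi
    have hiS : i ∉ S := fun h => hi (Finset.mem_union_left _ h)
    obtain ⟨hN, hf, hx, hb⟩ := hS i hiS
    refine (eventually_periodic_and_abv_cyc_eq_one (W.nonarch i hN) hf hx hne hb).2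
      m hm A B hAB ?_ k
    by_contra h
    exact hi (Finset.mem_union_right _ (Finset.mem_sdiff.2 ⟨hE.mem_toFinset.2 h, hiS⟩))
  have hprod : ∀ k, (∏ i ∈ S, W.v i (cyc f m ((fun z => f.eval z)^[k] x))) *
      ∏ i ∈ E, W.v i (cyc f m ((fun z => f.eval z)^[k] x)) = 1 := fun k => by
    rw [← Finset.prod_union Finset.disjoint_sdiff]
    exact W.prod_eq_one (hc k) (hout k)
  have hη : ∀ i ∈ E, ∃ η > 0, ∃ k₁, ∀ k ≥ k₁,
      η * W.v i (cyc f m ((fun z => f.eval z)^[k] x)) ≤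
        W.v i (cyc f m ((fun z => f.eval z)^[k + 1] x)) := by
    intro i hi
    obtain ⟨hN, hf, hx, -⟩ := hS i (Finset.mem_sdiff.1 hi).2
    by_cases h : ∃ k₀, W.v i (cyc f m ((fun z => f.eval z)^[k₀] x)) < 1
    · obtain ⟨k₀, hk₀⟩ := h
      exact exists_eventually_mul_abv_cyc_le (W.nonarch i hN) hf hm hcop.of_mul_left_right
        hx hne hk₀
    · push Not at h
      refine ⟨1, one_pos, 0, fun k _ => ?_⟩
      rw [one_mul]
      exact (abv_cyc_le_one (W.nonarch i hN) hf m
        (abv_iterate_le_one (W.nonarch i hN) hf hx k)).trans (h _)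
  choose! η hη0 k₁ hη using hη
  refine ⟨(∏ i ∈ E, η i)⁻¹, inv_pos.2 (Finset.prod_pos hη0), E.sup k₁, fun k hk => ?_⟩
  have hP : 0 < ∏ i ∈ E, η i := Finset.prod_pos hη0
  have h1 : (∏ i ∈ E, η i) * ∏ i ∈ E, W.v i (cyc f m ((fun z => f.eval z)^[k] x)) ≤
      ∏ i ∈ E, W.v i (cyc f m ((fun z => f.eval z)^[k + 1] x)) := by
    rw [← Finset.prod_mul_distrib]
    exact Finset.prod_le_prod (fun i hi => mul_nonneg (hη0 i hi).le ((W.v i).nonneg _))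
      fun i hi => hη i hi k ((Finset.le_sup hi).trans hk)
  have hpos : ∀ (T : Finset W.ι) (k : ℕ),
      0 < ∏ i ∈ T, W.v i (cyc f m ((fun z => f.eval z)^[k] x)) := fun T k =>
    Finset.prod_pos fun i _ => (W.v i).pos (hc k)
  rw [inv_mul_eq_div, le_div_iff₀ hP]
  refine le_of_mul_le_mul_right ?_ (hpos E k)
  rw [hprod k, ← hprod (k + 1), mul_assoc]
  exact mul_le_mul_of_nonneg_left h1 (hpos S _).le

lemma exists_prod_max_one_le [CharZero K] (hfd : 2 ≤ f.natDegree) (hq : q ≠ 0)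
    (hinj : Function.Injective fun k : ℕ => (fun z => f.eval z)^[k] x) :
    ∃ B : ℝ, ∃ k₀, ∀ k ≥ k₀, ∏ i ∈ S, max 1 (W.v i ((fun z => f.eval z)^[k] x)) ≤ B := by
  classical
  have hc : ∀ m ≠ 0, ∀ k, cyc f m ((fun z => f.eval z)^[k] x) ≠ 0 := fun m hm k h => by
    have := cyc_mul_sub f m ((fun z => f.eval z)^[k] x)
    rw [h, zero_mul, ← Function.iterate_add_apply, eq_comm, sub_eq_zero] at this
    have := hinj this
    omega
  have hf' : f.derivative ≠ 0 := fun h => by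
    have := derivative_eq_zero.1 h
    omega
  have hinf := Nat.infinite_setOfPred_prime.sdiff
    (finite_primes_not_isCoprime_cycPoly f (mul_ne_zero hq hf'))
  obtain ⟨M, hM, hcard⟩ := hinf.exists_subset_card_eq (S.card + 1)
  have hMp : ∀ m ∈ M, m.Prime := fun m hm => (hM hm).1
  have hM0 : ∀ m ∈ M, m ≠ 0 := fun m hm => (hMp m hm).ne_zero
  have hMc : ∀ m ∈ M, IsCoprime (q * f.derivative) (cycPoly f m) := fun m hm => by
    by_contra h
    exact (hM hm).2 ⟨hMp m hm, h⟩
  have h1 : ∀ m ∈ M, _ := fun m hm => exists_prod_abv_cyc_le hS hinj (hM0 m hm) (hMc m hm)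
  choose! C hC k₀ hk₀ using h1
  have hdeg : ∀ m ∈ M, (cycPoly f m).natDegree < ((cycPoly f m).comp f).natDegree := by
    intro m hm
    have := natDegree_cycPoly_pos hfd (hMp m hm).two_le
    rw [natDegree_comp]
    nlinarith
  have h2 : ∀ i ∈ S, ∀ m ∈ M, ∀ m' ∈ M, m ≠ m' → ∃ c > 0, ∀ y,
      c * max 1 (W.v i y) * W.v i ((cycPoly f m).eval y) ≤
        W.v i (((cycPoly f m).comp f).eval y) ∨
      c * max 1 (W.v i y) * W.v i ((cycPoly f m').eval y) ≤
        W.v i (((cycPoly f m').comp f).eval y) := by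
    intro i _ m hm m' hm' hmm
    refine exists_mul_abv_eval_le_or_of_isCoprime _ (hdeg m hm) (hdeg m' hm') ?_
    exact (isCoprime_cycPoly f (hM0 m hm)
      ((Nat.coprime_primes (hMp m hm) (hMp m' hm')).2 hmm)).map (compRingHom f)
  choose! c hc0 hcc using h2
  obtain ⟨c₀, hc₀, hc₀'⟩ := exists_pos_le_of_finset (S ×ˢ M.offDiag)
    (fun t => c t.1 t.2.1 t.2.2) fun t ht => by
      obtain ⟨h1, h2⟩ := Finset.mem_product.1 ht
      obtain ⟨h3, h4, h5⟩ := Finset.mem_offDiag.1 h2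
      exact hc0 _ h1 _ h3 _ h4 h5
  refine ⟨(∑ m ∈ M, C m) / c₀ ^ S.card, M.sup k₀, fun k hk => ?_⟩
  set y := (fun z => f.eval z)^[k] x with hy
  obtain ⟨m, hm, hgood⟩ : ∃ m ∈ M, ∀ i ∈ S,
      c₀ * max 1 (W.v i y) * W.v i ((cycPoly f m).eval y) ≤
        W.v i (((cycPoly f m).comp f).eval y) := by
    by_contra! hbad
    have : Nonempty W.ι := ⟨W.infinite.nonempty.some⟩
    choose! g hg hbad using hbad
    obtain ⟨m, hm, m', hm', hmm, hgm⟩ :=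
      Finset.exists_ne_map_eq_of_card_lt_of_maps_to (by omega : S.card < M.card) hg
    have hlt := hc₀' (g m, m, m') (by simp [hg m hm, hm, hm', hmm])
    have hle : ∀ n, c₀ * max 1 (W.v (g m) y) * W.v (g m) ((cycPoly f n).eval y) ≤
        c (g m) m m' * max 1 (W.v (g m) y) * W.v (g m) ((cycPoly f n).eval y) := fun n => by
      have := (W.v (g m)).nonneg ((cycPoly f n).eval y)
      gcongr
    rcases hcc (g m) (hg m hm) m hm m' hm' hmm y with h | h
    · exact absurd ((hle m).trans h) (not_le.2 (hbad m hm))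
    · rw [hgm] at h hle
      exact absurd ((hle m').trans h) (not_le.2 (hbad m' hm'))
  have h3 := Finset.prod_le_prod (fun i _ => by
    have := (W.v i).nonneg ((cycPoly f m).eval y); positivity) hgood
  rw [Finset.prod_mul_distrib, Finset.prod_mul_distrib, Finset.prod_const] at h3
  simp only [eval_comp, eval_cycPoly] at h3
  have h4 := hk₀ m hm k ((Finset.le_sup hm).trans hk)
  simp only [Function.iterate_succ_apply'] at h4
  have hpos : 0 < ∏ i ∈ S, W.v i (cyc f m y) :=
    Finset.prod_pos fun i _ => (W.v i).pos (hc m (hM0 m hm) k)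
  have h5 := le_of_mul_le_mul_right (h3.trans h4) hpos
  rw [le_div_iff₀ (pow_pos hc₀ _), mul_comm]
  exact h5.trans (Finset.single_le_sum (f := C) (fun m hm => (hC m hm).le) hm)

end

/-- There are infinitely many nonarchimedean places at which the orbit of a wandering point avoids
the residue classes of the roots of `q` from some time on. -/
theorem infinite_orbitAvoidsRoots [CharZero K] {f q : K[X]} (hfd : 2 ≤ f.natDegree) (hq : q ≠ 0)
    {x : K} (hinj : Function.Injective fun k : ℕ => (fun z => f.eval z)^[k] x) :
    {i ∈ W.N | OrbitAvoidsRoots (W.v i) f q x}.Infinite := by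
  classical
  intro hfin
  have hSfin := ((W.finite_compl.union hfin).union (W.finite_exists_coeff_not_integral f)).union
    (W.finite_not_integral x)
  set S := hSfin.toFinset with hSdef
  have hS : ∀ i ∉ S, i ∈ W.N ∧
      (∀ n, W.v i (f.coeff n) ≤ 1) ∧ W.v i x ≤ 1 ∧ ¬ OrbitAvoidsRoots (W.v i) f q x := by
    intro i hi
    simp only [hSdef, Set.Finite.mem_toFinset, Set.mem_union, Set.mem_compl_iff, Set.mem_ofPred_eq,
      not_or, not_not, not_and] at hi
    exact ⟨hi.1.1.1, hi.1.2, hi.2, hi.1.1.2 hi.1.1.1⟩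
  have hne : ∀ k, (fun z => f.eval z)^[k + 1] x ≠ (fun z => f.eval z)^[k] x := fun k h => by
    have := hinj h; omega
  obtain ⟨B, k₀, hB⟩ := exists_prod_max_one_le hS hfd hq hinj
  obtain ⟨r, hr⟩ := pow_unbounded_of_one_lt (2 ^ S.card * (B * B)) (one_lt_two (α := ℝ))
  obtain ⟨I, hI, hIr⟩ := (W.infinite.sdiff S.finite_toSet).exists_subset_card_eq r
  have hper : ∀ i ∈ I, _ := fun i hi =>
    have hi' := hS i (hI hi).2
    (eventually_periodic_and_abv_cyc_eq_one (W.nonarch i hi'.1) hi'.2.1 hi'.2.2.1 hne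
      hi'.2.2.2).1
  choose! n hn1 k₁ hk₁ using hper
  set M := ∏ i ∈ I, n i with hM
  have hM0 : 0 < M := Finset.prod_pos hn1
  set k := max k₀ (I.sup k₁) with hk
  set z := (fun z => f.eval z)^[k + M] x - (fun z => f.eval z)^[k] x with hz
  have hz0 : z ≠ 0 := sub_ne_zero.2 fun h => by
    have := hinj h; omega
  have horb : ∀ i ∉ S, ∀ l, W.v i ((fun z => f.eval z)^[l] x) ≤ 1 := fun i hi l =>
    abv_iterate_le_one (W.nonarch i (hS i hi).1) (hS i hi).2.1 (hS i hi).2.2.1 l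
  have hdisj : Disjoint S I := Finset.disjoint_right.2 fun i hi => (hI hi).2
  have h1 := W.one_le_prod hz0 (T := S ∪ I) fun i hi => by
    have hiS : i ∉ S := fun h => hi (Finset.mem_union_left _ h)
    exact (abv_sub_le_max (W.nonarch i (hS i hiS).1) _ _).trans
      (max_le (horb i hiS _) (horb i hiS _))
  rw [Finset.prod_union hdisj] at h1
  have h2 : ∏ i ∈ I, W.v i z ≤ (1 / 2) ^ r := by
    rw [← hIr, ← Finset.prod_const]
    refine Finset.prod_le_prod (fun i _ => (W.v i).nonneg z) fun i hi => ?_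
    refine W.discrete i (hI hi).1 z ?_
    obtain ⟨j, hj⟩ := Finset.dvd_prod_of_mem n hi
    have := hk₁ i hi k ((Finset.le_sup hi).trans (le_max_right _ _)) j
    rwa [mul_comm, ← hj] at this
  have h3 : ∏ i ∈ S, W.v i z ≤ 2 ^ S.card * (B * B) := by
    calc _ ≤ ∏ i ∈ S, 2 * (max 1 (W.v i ((fun z => f.eval z)^[k + M] x)) *
          max 1 (W.v i ((fun z => f.eval z)^[k] x))) := by
          refine Finset.prod_le_prod (fun i _ => (W.v i).nonneg z) fun i _ => ?_
          have h4 := (W.v i).sub_le_add ((fun z => f.eval z)^[k + M] x) ((fun z => f.eval z)^[k] x)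
          set a := W.v i ((fun z => f.eval z)^[k + M] x)
          set b := W.v i ((fun z => f.eval z)^[k] x)
          have ha : a ≤ max 1 a := le_max_right _ _
          have hb : b ≤ max 1 b := le_max_right _ _
          have ha1 : 1 ≤ max 1 a := le_max_left _ _
          have hb1 : 1 ≤ max 1 b := le_max_left _ _
          nlinarith
      _ = 2 ^ S.card * ((∏ i ∈ S, max 1 (W.v i ((fun z => f.eval z)^[k + M] x))) *
          ∏ i ∈ S, max 1 (W.v i ((fun z => f.eval z)^[k] x))) := by
          rw [Finset.prod_mul_distrib, Finset.prod_const, Finset.prod_mul_distrib]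
      _ ≤ _ := by
          have hk' := hB k (le_max_left _ _)
          have hkM := hB (k + M) ((le_max_left _ _).trans (Nat.le_add_right _ _))
          have hp : ∀ l, 0 ≤ ∏ i ∈ S, max 1 (W.v i ((fun z => f.eval z)^[l] x)) := fun l =>
            Finset.prod_nonneg fun i _ => by positivity
          gcongr
          · exact (hp k).trans hk'
  have h4 : 0 ≤ ∏ i ∈ S, W.v i z := Finset.prod_nonneg fun i _ => (W.v i).nonneg z
  have h5 : (1 : ℝ) ≤ 2 ^ S.card * (B * B) * (1 / 2) ^ r :=
    h1.trans (mul_le_mul h3 h2 (Finset.prod_nonneg fun i _ => (W.v i).nonneg z) (h4.trans h3))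
  rw [one_div, inv_pow, ← div_eq_mul_inv, le_div_iff₀ (by positivity), one_mul] at h5
  linarith

end ProductFormulaPlaces

section Zariski

variable {L : Type} [Field L] {ι : Type} [DecidableEq ι]

/-- The homogeneous coordinates of a point of `(P^1)^ι`, as a single vector. -/
def coordVec {L : Type} [CommRing L] {ι : Type} (x : ι → OnePoint L) : ι × Fin 2 → L :=
  fun jk => homCoords (x jk.1) jk.2

lemma vanishesAt_iff {K L : Type} [CommRing K] [CommRing L] (φ : K →+* L)
    (p : MvPolynomial (ι × Fin 2) K) (x : ι → OnePoint L) :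
    vanishesAt φ p x ↔ MvPolynomial.eval₂ φ (coordVec x) p = 0 := by
  rw [vanishesAt, MvPolynomial.eval_map]; rfl

lemma MultiHomog.map {K L : Type} [CommRing K] [CommRing L] (φ : K →+* L)
    {p : MvPolynomial (ι × Fin 2) K} (hp : MultiHomog p) : MultiHomog (MvPolynomial.map φ p) := by
  intro i
  obtain ⟨d, hd⟩ := hp i
  refine ⟨d, fun m hm => hd ?_⟩
  contrapose! hm
  rw [MvPolynomial.coeff_map, hm, map_zero]

lemma ClosedSubvar.isZarClosed_pts {K L : Type} [CommRing K] [CommRing L] (φ : K →+* L)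
    (V : ClosedSubvar K ι) : IsZarClosed (V.pts φ) := by
  refine ⟨⟨MvPolynomial.map φ '' V.polys, ?_⟩, ?_⟩
  · rintro _ ⟨p, hp, rfl⟩
    exact (V.homog p hp).map φ
  · ext x
    simp [ClosedSubvar.pts, vanishesAt]

lemma IsZarClosed.inter {Z₁ Z₂ : Set (ι → OnePoint L)} (h₁ : IsZarClosed Z₁)
    (h₂ : IsZarClosed Z₂) : IsZarClosed (Z₁ ∩ Z₂) := by
  obtain ⟨V₁, rfl⟩ := h₁
  obtain ⟨V₂, rfl⟩ := h₂
  refine ⟨⟨V₁.polys ∪ V₂.polys, fun p hp => hp.elim (V₁.homog p) (V₂.homog p)⟩, ?_⟩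
  ext x
  simp only [ClosedSubvar.pts, Set.mem_inter_iff, Set.mem_ofPred_eq, Set.mem_union]
  exact ⟨fun h p hp => hp.elim (h.1 p) (h.2 p), fun h => ⟨fun p hp => h p (Or.inl hp),
    fun p hp => h p (Or.inr hp)⟩⟩

lemma homCoords_injective_proj {x y : OnePoint L}
    (h : homCoords y 0 * homCoords x 1 = homCoords y 1 * homCoords x 0) : y = x := by
  induction x using OnePoint.rec with
  | infty =>
    induction y using OnePoint.rec with
    | infty => rfl
    | coe b => exact absurd h (by change ¬ (b * 0 = 1 * 1); simp)
  | coe a =>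
    induction y using OnePoint.rec with
    | infty => exact absurd h (by change ¬ ((1 : L) * 1 = 0 * a); simp)
    | coe b =>
      have : b * 1 = 1 * a := h
      rw [mul_one, one_mul] at this
      rw [this]

lemma isZarClosed_singleton (t : ι → OnePoint L) : IsZarClosed {t} := by
  refine ⟨⟨Set.range fun i : ι => MvPolynomial.C (homCoords (t i) 1) * MvPolynomial.X (i, 0) -
    MvPolynomial.C (homCoords (t i) 0) * MvPolynomial.X (i, 1), ?_⟩, ?_⟩
  · rintro _ ⟨i, rfl⟩ j
    refine ⟨if i = j then 1 else 0, MvPolynomial.IsWeightedHomogeneous.sub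
      (MvPolynomial.IsWeightedHomogeneous.C_mul ?_ _)
      (MvPolynomial.IsWeightedHomogeneous.C_mul ?_ _)⟩
    · exact MvPolynomial.isWeightedHomogeneous_X L
        (fun jk : ι × Fin 2 => if jk.1 = j then 1 else 0) (i, 0)
    · exact MvPolynomial.isWeightedHomogeneous_X L
        (fun jk : ι × Fin 2 => if jk.1 = j then 1 else 0) (i, 1)
  · ext y
    simp only [ClosedSubvar.pts, vanishesAt, Set.mem_ofPred_eq, Set.forall_mem_range,
      MvPolynomial.map_id, Set.mem_singleton_iff, map_sub, map_mul, MvPolynomial.eval_C,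
      MvPolynomial.eval_X]
    constructor
    · rintro rfl i
      ring
    · intro h
      funext i
      refine homCoords_injective_proj ?_
      linear_combination h i

lemma irrSubvar_singleton (t : ι → OnePoint L) : IrrSubvar {t} := by
  refine ⟨Set.singleton_nonempty t, isZarClosed_singleton t, fun Z₁ Z₂ _ _ h => ?_⟩
  simpa using h

/-- The ideal of polynomials vanishing on a set of points. -/
def idealOf (Z : Set (ι → OnePoint L)) : Ideal (MvPolynomial (ι × Fin 2) L) :=
  MvPolynomial.vanishingIdeal L (coordVec '' Z)

lemma mem_idealOf {Z : Set (ι → OnePoint L)} {p : MvPolynomial (ι × Fin 2) L} :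
    p ∈ idealOf Z ↔ ∀ x ∈ Z, vanishesAt (RingHom.id L) p x := by
  rw [idealOf, MvPolynomial.mem_vanishingIdeal_iff, Set.forall_mem_image]
  simp only [vanishesAt_iff]
  rfl

lemma IsZarClosed.idealOf_lt {Z₁ Z₂ : Set (ι → OnePoint L)} (h₁ : IsZarClosed Z₁)
    (h : Z₁ ⊂ Z₂) : idealOf Z₂ < idealOf Z₁ := by
  rw [Set.ssubset_iff_subset_ne] at h
  refine lt_of_le_of_ne (fun p hp => mem_idealOf.2 fun x hx => mem_idealOf.1 hp x (h.1 hx))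
    fun he => h.2 (h.1.antisymm ?_)
  obtain ⟨V, rfl⟩ := h₁
  intro x hx p hp
  have : p ∈ idealOf (V.pts (RingHom.id L)) := mem_idealOf.2 fun y hy => hy p hp
  rw [← he] at this
  exact mem_idealOf.1 this x hx

/-- A Zariski closed set of dimension `0` is finite. -/
theorem IsZarClosed.finite_of_varDim_eq_zero [Finite ι] {S : Set (ι → OnePoint L)}
    (hS : IsZarClosed S) (hdim : varDim S = ((0 : ℕ∞) : WithBot ℕ∞)) : S.Finite := by
  have hirr : ∀ T, IrrSubvar T → T ⊆ S → T.Finite := by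
    intro T hT hTS
    obtain ⟨t, ht⟩ := hT.1
    have hmax := Order.krullDim_nonpos_iff_forall_isMax.1
      (show varDim S ≤ 0 by rw [hdim]; exact le_rfl)
    have hts : ({t} : Set _) ⊆ T := Set.singleton_subset_iff.2 ht
    have := hmax ⟨{t}, irrSubvar_singleton t, hts.trans hTS⟩ (b := ⟨T, hT, hTS⟩) hts
    exact (Set.finite_singleton t).subset this
  have hwf : WellFounded fun Z₁ Z₂ : Set (ι → OnePoint L) => idealOf Z₁ > idealOf Z₂ :=
    InvImage.wf idealOf (wellFounded_gt (α := Ideal (MvPolynomial (ι × Fin 2) L)))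
  have key : ∀ Z : Set (ι → OnePoint L), IsZarClosed Z → Z ⊆ S → Z.Finite := by
    intro Z
    induction Z using hwf.induction with
    | _ Z ih =>
      intro hZ hZS
      rcases Z.eq_empty_or_nonempty with rfl | hne
      · exact Set.finite_empty
      by_cases hI : IrrSubvar Z
      · exact hirr Z hI hZS
      · simp only [IrrSubvar, hne, hZ, true_and, not_forall, not_or, exists_prop] at hI
        obtain ⟨Z₁, Z₂, h₁, h₂, hsub, hn₁, hn₂⟩ := hI
        have hfin : ∀ Y, IsZarClosed Y → ¬ Z ⊆ Y → (Z ∩ Y).Finite := fun Y hY hn =>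
          ih _ ((hZ.inter hY).idealOf_lt (Set.ssubset_iff_subset_ne.2 ⟨Set.inter_subset_left,
            fun h => hn (Set.inter_eq_left.1 h)⟩)) (hZ.inter hY) (Set.inter_subset_left.trans hZS)
        refine ((hfin Z₁ h₁ hn₁).union (hfin Z₂ h₂ hn₂)).subset ?_
        rw [← Set.inter_union_distrib_left]
        exact Set.subset_inter subset_rfl hsub
  exact key S hS subset_rfl

end Zariski

section Nullstellensatz

variable {K : Type} [Field K] {ι : Type} [DecidableEq ι] [Finite ι]

/-- If `V` has finitely many geometric points, then the finite coordinates of its points over any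
extension are roots of a fixed polynomial. -/
theorem ClosedSubvar.exists_eval_map_eq_zero (V : ClosedSubvar K ι)
    (hV : (V.pts (algebraMap K (AlgebraicClosure K))).Finite) (i : ι) :
    ∃ q : K[X], q ≠ 0 ∧ ∀ (L : Type) [Field L] (φ : K →+* L), ∀ y ∈ V.pts φ, ∀ b : L, y i = b →
      (q.map φ).eval b = 0 := by
  classical
  have hA : ((fun a : AlgebraicClosure K => (a : OnePoint (AlgebraicClosure K))) ⁻¹'
      ((fun y => y i) '' V.pts (algebraMap K (AlgebraicClosure K)))).Finite :=
    (hV.image _).preimage (OnePoint.coe_injective.injOn)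
  refine ⟨∏ a ∈ hA.toFinset, minpoly K a, Finset.prod_ne_zero_iff.2 fun a _ =>
    minpoly.ne_zero (Algebra.IsIntegral.isIntegral a), fun L _ φ y hy b hb => ?_⟩
  set q := ∏ a ∈ hA.toFinset, minpoly K a with hq
  let s : ∀ (R : Type) [CommRing R], (ι → R) → ι × Fin 2 → R := fun R _ z jk =>
    if y jk.1 = ∞ then ![1, 0] jk.2 else ![z jk.1, 1] jk.2
  have hs : ∀ (R : Type) [CommRing R] (z : ι → R),
      coordVec (fun j => if y j = ∞ then ∞ else (z j : OnePoint R)) = s R z := by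
    intro R _ z
    funext jk
    simp only [coordVec, s]
    split_ifs <;> rfl
  have hsmap : ∀ (R : Type) [CommRing R] (g : MvPolynomial ι K →+* R) (jk : ι × Fin 2),
      g (s _ MvPolynomial.X jk) = s R (fun j => g (MvPolynomial.X j)) jk := by
    intro R _ g ⟨j, k⟩
    simp only [s]
    split_ifs <;> fin_cases k <;> simp
  have hg : ∀ (R : Type) [CommRing R] (g : MvPolynomial ι K →+* R) (p : MvPolynomial (ι × Fin 2) K),
      g (MvPolynomial.bind₁ (s _ MvPolynomial.X) p) =
        MvPolynomial.eval₂ (g.comp MvPolynomial.C) (s R fun j => g (MvPolynomial.X j)) p := by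
    intro R _ g p
    induction p using MvPolynomial.induction_on with
    | C a => simp
    | add p q hp hq => rw [map_add, map_add, hp, hq, MvPolynomial.eval₂_add]
    | mul_X p jk hp => rw [map_mul, map_mul, hp, MvPolynomial.eval₂_mul, MvPolynomial.bind₁_X_right,
        MvPolynomial.eval₂_X, hsmap]
  set I : Ideal (MvPolynomial ι K) :=
    Ideal.span ((fun p => MvPolynomial.bind₁ (s _ MvPolynomial.X) p) '' V.polys) with hI
  have hvan : Polynomial.aeval (MvPolynomial.X i) q ∈
      MvPolynomial.vanishingIdeal K (MvPolynomial.zeroLocus (AlgebraicClosure K) I) := by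
    rw [MvPolynomial.mem_vanishingIdeal_iff]
    intro z hz
    have hmem : (fun j => if y j = ∞ then ∞ else (z j : OnePoint (AlgebraicClosure K))) ∈
        V.pts (algebraMap K (AlgebraicClosure K)) := by
      intro p hp
      rw [vanishesAt_iff, hs]
      have := hz _ (Ideal.subset_span ⟨p, hp, rfl⟩)
      have h2 := hg _ (MvPolynomial.aeval z : MvPolynomial ι K →ₐ[K] AlgebraicClosure K).toRingHom p
      have h3 : (MvPolynomial.aeval z : MvPolynomial ι K →ₐ[K] AlgebraicClosure K).toRingHom.comp
          MvPolynomial.C = algebraMap K (AlgebraicClosure K) := by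
        ext a; simp
      rw [h3] at h2
      simp only [AlgHom.toRingHom_eq_coe, RingHom.coe_coe, MvPolynomial.aeval_X] at h2
      rw [← h2]
      exact this
    have hz' : z i ∈ hA.toFinset := by
      rw [Set.Finite.mem_toFinset]
      exact ⟨_, hmem, by simp [hb]⟩
    rw [← Polynomial.aeval_algHom_apply, MvPolynomial.aeval_X, hq, map_prod]
    exact Finset.prod_eq_zero hz' (minpoly.aeval K _)
  rw [MvPolynomial.vanishingIdeal_zeroLocus_eq_radical] at hvan
  obtain ⟨N, hN⟩ := hvan
  have hy' : ∃ z : ι → L, y = fun j => if y j = ∞ then ∞ else (z j : OnePoint L) := by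
    refine ⟨fun j => (y j).elim 0 id, ?_⟩
    funext j
    split_ifs with h
    · exact h
    · obtain ⟨c, hc⟩ := OnePoint.ne_infty_iff_exists.1 h
      beta_reduce
      rw [← hc]
      rfl
  obtain ⟨z, hz⟩ := hy'
  have hker : I ≤ RingHom.ker (MvPolynomial.eval₂Hom φ z) := by
    rw [hI, Ideal.span_le]
    rintro _ ⟨p, hp, rfl⟩
    rw [SetLike.mem_coe, RingHom.mem_ker, hg]
    have h1 := (vanishesAt_iff φ p y).1 (hy p hp)
    have h3 : (MvPolynomial.eval₂Hom φ z).comp MvPolynomial.C = φ := by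
      ext a; simp
    rw [hz, hs] at h1
    rw [h3]
    simpa using h1
  have h := hker hN
  rw [RingHom.mem_ker, map_pow] at h
  have h := eq_zero_of_pow_eq_zero h
  have hzb : z i = b := by
    have := congrFun hz i
    rw [hb] at this
    simpa using this.symm
  rw [Polynomial.aeval_def, Polynomial.hom_eval₂] at h
  have h3 : (MvPolynomial.eval₂Hom φ z).comp (algebraMap K (MvPolynomial ι K)) = φ := by
    ext a; simp
  rw [h3] at h
  simpa [eval_map, hzb] using h

end Nullstellensatz

section ProjectiveTopology

variable {L : Type} [Field L] (w : AbsoluteValue L ℝ)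

lemma p1Dist_self (x : OnePoint L) : p1Dist w x x = 0 := by
  induction x using OnePoint.rec with
  | infty => rfl
  | coe a =>
    change w (a - a) / _ = 0
    simp

lemma p1Dist_pos {x y : OnePoint L} (h : x ≠ y) : 0 < p1Dist w x y := by
  induction x using OnePoint.rec with
  | infty =>
    induction y using OnePoint.rec with
    | infty => exact absurd rfl h
    | coe b => change 0 < 1 / max 1 (w b); positivity
  | coe a =>
    induction y using OnePoint.rec with
    | infty => change 0 < 1 / max 1 (w a); positivity
    | coe b =>
      change 0 < w (a - b) / (max 1 (w a) * max 1 (w b))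
      have : 0 < w (a - b) := w.pos (sub_ne_zero.2 fun hab => h (by rw [hab]))
      positivity

lemma isOpen_p1Ball (x : OnePoint L) {ε : ℝ} (hε : 0 < ε) :
    @IsOpen _ (p1Top w) {y | p1Dist w x y < ε} :=
  TopologicalSpace.isOpen_generateFrom_of_mem ⟨x, ε, hε, rfl⟩

lemma t1Space_p1Top : @T1Space (OnePoint L) (p1Top w) := by
  let _ := p1Top w
  refine t1Space_iff_exists_open.2 fun x y h => ?_
  exact ⟨_, isOpen_p1Ball w x (p1Dist_pos w h), by simpa [p1Dist_self] using p1Dist_pos w h,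
    by simp⟩

/-- A point of the closure of `S` lies in `S` if some coordinate chart neighbourhood of it meets `S`
in a finite set only. -/
lemma mem_of_mem_adicClosure {ι : Type} {S : Set (ι → OnePoint L)} {y : ι → OnePoint L}
    (hy : y ∈ adicClosure w S) (i : ι) (hfin : {z ∈ S | p1Dist w (y i) (z i) < 1}.Finite) :
    y ∈ S := by
  let : TopologicalSpace (OnePoint L) := p1Top w
  have := t1Space_p1Top w
  have hy' : y ∈ closure S := hy
  have hc : Continuous fun z : ι → OnePoint L => z i := continuous_apply i
  have hU : IsOpen ((fun z : ι → OnePoint L => z i) ⁻¹' {u | p1Dist w (y i) u < 1}) :=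
    hc.isOpen_preimage _ (isOpen_p1Ball w (y i) one_pos)
  have hmem : y ∈ closure {z ∈ S | p1Dist w (y i) (z i) < 1} := by
    rw [mem_closure_iff] at hy' ⊢
    intro O hO hyO
    obtain ⟨z, ⟨hzO, hzU⟩, hzS⟩ := hy' _ (hO.inter hU) ⟨hyO, by
      simp [p1Dist_self]⟩
    exact ⟨z, hzO, hzS, hzU⟩
  rw [hfin.isClosed.closure_eq] at hmem
  exact hmem.1

/-- Points in a common chordal unit disc have the same integrality, and integral points in a common
chordal unit disc have the same reduction. -/
lemma exists_eq_coe_of_p1Dist_lt_one (hw : ∀ a b, w (a + b) ≤ max (w a) (w b)) {y : OnePoint L}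
    {x : L} (hx : w x ≤ 1) (h : p1Dist w y x < 1) :
    ∃ b : L, y = b ∧ w b ≤ 1 ∧ w (b - x) < 1 := by
  induction y using OnePoint.rec with
  | infty =>
    change 1 / max 1 (w x) < 1 at h
    rw [max_eq_left hx] at h
    norm_num at h
  | coe b =>
    change w (b - x) / (max 1 (w b) * max 1 (w x)) < 1 at h
    rw [max_eq_left hx, mul_one, div_lt_one (by positivity)] at h
    have hb : w b ≤ 1 := by
      by_contra! hb
      rw [max_eq_right hb.le] at h
      have := hw (b - x) x
      rw [sub_add_cancel] at this
      exact absurd (this.trans_lt (max_lt h (hx.trans_lt hb))) (lt_irrefl _)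
    exact ⟨b, rfl, hb, by rwa [max_eq_left hb] at h⟩

end ProjectiveTopology

section BaseChange

variable {K L : Type} [Field K] [Field L] (φ : K →+* L)

lemma splitMap_iterate_apply {ι : Type} (f : K[X]) (k : ℕ) (x : ι → OnePoint K) (i : ι) :
    (splitMap f)^[k] x i = (polyEvalP1 f)^[k] (x i) := by
  induction k with
  | zero => rfl
  | succ k ih => rw [Function.iterate_succ_apply', Function.iterate_succ_apply', ← ih]; rfl

lemma polyEvalP1_iterate_coe (f : K[X]) (k : ℕ) (a : K) :
    (polyEvalP1 f)^[k] (a : OnePoint K) = (((fun z => f.eval z)^[k] a : K) : OnePoint K) := by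
  induction k with
  | zero => rfl
  | succ k ih => rw [Function.iterate_succ_apply', Function.iterate_succ_apply', ih]; rfl

lemma polyEvalP1_iterate_infty (f : K[X]) (k : ℕ) :
    (polyEvalP1 f)^[k] (∞ : OnePoint K) = ∞ :=
  Function.iterate_fixed rfl k

lemma splitMap_map_iterate {ι : Type} (f : K[X]) (k : ℕ) (P : ι → OnePoint K) :
    (splitMap (f.map φ))^[k] (fun i => mapPoint φ (P i)) =
      fun i => mapPoint φ ((splitMap f)^[k] P i) := by
  funext i
  rw [splitMap_iterate_apply, splitMap_iterate_apply]
  induction P i using OnePoint.rec with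
  | infty => rw [polyEvalP1_iterate_infty]; exact polyEvalP1_iterate_infty _ k
  | coe a =>
    rw [polyEvalP1_iterate_coe]
    change (polyEvalP1 _)^[k] ((φ a : L) : OnePoint L) = ((φ _ : L) : OnePoint L)
    rw [polyEvalP1_iterate_coe, map_iterate_eval]

lemma homCoords_mapPoint (x : OnePoint K) (j : Fin 2) :
    homCoords (mapPoint φ x) j = φ (homCoords x j) := by
  induction x using OnePoint.rec with
  | infty =>
    change (![1, 0] : Fin 2 → L) j = φ ((![1, 0] : Fin 2 → K) j)
    fin_cases j <;> simp
  | coe a =>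
    change (![φ a, 1] : Fin 2 → L) j = φ ((![a, 1] : Fin 2 → K) j)
    fin_cases j <;> simp

lemma ClosedSubvar.mem_pts_of_mapPoint_mem {ι : Type} [DecidableEq ι] {V : ClosedSubvar K ι}
    {z : ι → OnePoint K} (h : (fun i => mapPoint φ (z i)) ∈ V.pts φ) :
    z ∈ V.pts (RingHom.id K) := by
  intro p hp
  have h1 := (vanishesAt_iff _ _ _).1 (h p hp)
  rw [vanishesAt_iff]
  have h2 : coordVec (fun i => mapPoint φ (z i)) = φ ∘ coordVec z := by
    funext jk
    exact homCoords_mapPoint φ _ _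
  rw [h2] at h1
  apply φ.injective
  rw [map_zero, ← h1, MvPolynomial.hom_eval₂, RingHomCompTriple.comp_eq]
  rfl

end BaseChange

lemma finite_range_iterate_of_not_injective {α : Type*} {g : α → α} {x : α}
    (h : ¬ Function.Injective fun k : ℕ => g^[k] x) : (Set.range fun k : ℕ => g^[k] x).Finite := by
  obtain ⟨k, l, hkl, heq⟩ : ∃ k l, k < l ∧ g^[k] x = g^[l] x := by
    simp only [Function.Injective, not_forall] at h
    obtain ⟨k, l, heq, hne⟩ := h
    rcases lt_or_gt_of_ne hne with h | h
    · exact ⟨k, l, h, heq⟩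
    · exact ⟨l, k, h, heq.symm⟩
  refine ((Set.finite_lt_nat l).image fun k => g^[k] x).subset ?_
  rintro _ ⟨n, rfl⟩
  induction n using Nat.strong_induction_on with
  | _ n ih =>
    rcases lt_or_ge n l with hn | hn
    · exact ⟨n, hn, rfl⟩
    · obtain ⟨d, rfl⟩ := Nat.exists_eq_add_of_le' hn
      have := ih (d + k) (by omega)
      beta_reduce at this ⊢
      rwa [Function.iterate_add_apply, heq, ← Function.iterate_add_apply] at this

section Places

variable {K : Type} [Field K]

lemma CompletionOf.nonarch {w : PlaceK K} (hw : w.IsNonarch) (C : CompletionOf w)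
    (a b : C.carrier) : C.absv (a + b) ≤ max (C.absv a) (C.absv b) := by
  refine le_of_forall_pos_le_add fun ε hε => ?_
  obtain ⟨x, hx⟩ := C.dense a (ε / 3) (by positivity)
  obtain ⟨y, hy⟩ := C.dense b (ε / 3) (by positivity)
  have h1 := hw x y
  rw [← C.compat, ← C.compat, ← C.compat, map_add] at h1
  have h2 : C.absv (a + b) ≤ C.absv (C.emb x + C.emb y) +
      (C.absv (a - C.emb x) + C.absv (b - C.emb y)) := by
    calc C.absv (a + b) = C.absv (C.emb x + C.emb y + ((a - C.emb x) + (b - C.emb y))) := by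
          congr 1; ring
      _ ≤ _ := (C.absv.add_le _ _).trans (by gcongr; exact C.absv.add_le _ _)
  have h3 : C.absv (C.emb x) ≤ C.absv a + ε / 3 := by
    have := C.absv.sub_le_add a (a - C.emb x)
    rw [sub_sub_cancel] at this
    linarith
  have h4 : C.absv (C.emb y) ≤ C.absv b + ε / 3 := by
    have := C.absv.sub_le_add b (b - C.emb y)
    rw [sub_sub_cancel] at this
    linarith
  have h5 : max (C.absv (C.emb x)) (C.absv (C.emb y)) ≤ max (C.absv a) (C.absv b) + ε / 3 :=
    max_le (h3.trans (by gcongr; exact le_max_left _ _))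
      (h4.trans (by gcongr; exact le_max_right _ _))
  linarith

lemma ProductFormulaPlaces.infinitelyManyPlaces {κ : Subfield K} (W : ProductFormulaPlaces K κ)
    {Q : PlaceK K → Prop} {G : Set W.ι} (hG : G.Infinite) (hGN : G ⊆ W.N)
    (hQ : ∀ i ∈ G, ∀ w : PlaceK K, w.v = W.v i → Q w) : InfinitelyManyPlaces K κ Q := by
  have hnt : ∀ i : G, ∃ x : K, x ≠ 0 ∧ W.v i x ≠ 1 := by
    rintro ⟨i, hi⟩
    obtain ⟨j, hj, hji⟩ := W.infinite.exists_notMem_finset {i}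
    obtain ⟨x, hx, hx'⟩ := W.separating i (hGN hi) j hj (fun h => hji (by simp [h]))
    exact ⟨x, by rintro rfl; simp at hx', hx.ne⟩
  set g : G → PlaceK K := fun i => ⟨W.v i, hnt i⟩ with hg
  have hne : ∀ i j : G, i ≠ j → ¬ PlaceK.Equiv (g i) (g j) := fun i j hij h => by
    obtain ⟨x, hx, hx'⟩ := W.separating i (hGN i.2) j (hGN j.2) (fun h => hij (Subtype.ext h))
    exact hx' ((h x).1 hx)
  have hinj : Function.Injective g := fun i j h => by
    by_contra hij
    exact hne i j hij (h ▸ fun x => Iff.rfl)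
  have := hG.to_subtype
  refine ⟨Set.range g, Set.infinite_range_of_injective hinj, ?_, ?_⟩
  · rintro _ ⟨i, rfl⟩ _ ⟨j, rfl⟩ h
    exact hne i j fun hij => h (by rw [hij])
  · rintro _ ⟨i, rfl⟩
    exact ⟨W.nonarch i (hGN i.2), W.trivial_on_constants.imp id fun h => h i (hGN i.2),
      hQ i i.2 _ rfl⟩

/-- If the orbit has a point of `V` in its closure, then that point is not isolated in the orbit. -/
lemma orbitClosureAvoids_of_finite {n : ℕ} {w : PlaceK K} {f : K[X]} {P : Fin n → OnePoint K}
    {V : ClosedSubvar K (Fin n)} (hP : fwdOrbit (splitMap f) P ∩ V.pts (RingHom.id K) = ∅)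
    (i : Fin n) (h : ∀ C : CompletionOf w, ∀ y ∈ V.pts C.emb,
      {z ∈ fwdOrbit (splitMap (f.map C.emb)) fun i => mapPoint C.emb (P i) |
        p1Dist C.absv (y i) (z i) < 1}.Finite) : OrbitClosureAvoids w f P V := by
  intro C
  rw [Set.eq_empty_iff_forall_notMem]
  rintro y ⟨hy, hyV⟩
  obtain ⟨k, rfl⟩ := mem_of_mem_adicClosure C.absv hy i (h C y hyV)
  simp only [splitMap_map_iterate] at hyV
  have : (splitMap f)^[k] P ∈ fwdOrbit (splitMap f) P ∩ V.pts (RingHom.id K) :=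
    ⟨⟨k, rfl⟩, ClosedSubvar.mem_pts_of_mapPoint_mem C.emb hyV⟩
  rw [hP] at this
  exact this

end Places

theorem infinitelyManyPlaces_orbitClosureAvoids
    {K : Type} [Field K] [CharZero K] {κ : Subfield K} (W : ProductFormulaPlaces K κ)
    {n : ℕ} (hn : 2 ≤ n) {f : Polynomial K} (hf : 2 ≤ f.natDegree)
    {V : ClosedSubvar K (Fin n)}
    (hVdim : varDim (V.pts (algebraMap K (AlgebraicClosure K))) = ((0 : ℕ∞) : WithBot ℕ∞))
    {P : Fin n → OnePoint K}
    (hP : fwdOrbit (splitMap f) P ∩ V.pts (RingHom.id K) = ∅) :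
    InfinitelyManyPlaces K κ fun w => OrbitClosureAvoids w f P V := by
  by_cases hinf : ∃ i, ∃ x : K, P i = x ∧
      Function.Injective fun k : ℕ => (fun z => f.eval z)^[k] x
  · obtain ⟨i, x, hx, hinj⟩ := hinf
    obtain ⟨q, hq, hroot⟩ := V.exists_eval_map_eq_zero
      ((V.isZarClosed_pts _).finite_of_varDim_eq_zero hVdim) i
    refine W.infinitelyManyPlaces (W.infinite_orbitAvoidsRoots hf hq hinj) (fun _ h => h.1) ?_
    rintro j ⟨hj, hfj, hxj, havoid⟩ w hw
    have hna : w.IsNonarch := by rw [PlaceK.IsNonarch, hw]; exact W.nonarch j hj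
    refine orbitClosureAvoids_of_finite hP i fun C y hy => ?_
    have horb : ∀ k, (splitMap (f.map C.emb))^[k] (fun i => mapPoint C.emb (P i)) i =
        ((C.emb ((fun z => f.eval z)^[k] x) : C.carrier) : OnePoint C.carrier) := by
      intro k
      rw [splitMap_map_iterate]
      beta_reduce
      rw [splitMap_iterate_apply, hx, polyEvalP1_iterate_coe]
      rfl
    have hle1 : ∀ k, C.absv (C.emb ((fun z => f.eval z)^[k] x)) ≤ 1 := fun k => by
      rw [C.compat, hw]
      exact abv_iterate_le_one (W.nonarch j hj) hfj hxj k
    by_cases hyi : ∃ b : C.carrier, y i = b ∧ C.absv b ≤ 1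
    · obtain ⟨b, hyb, hb⟩ := hyi
      refine ((havoid C.carrier C.emb C.absv (C.nonarch hna) (fun a => by rw [C.compat, hw]) b hb
        (hroot C.carrier C.emb y hy b hyb)).image fun k =>
          (splitMap (f.map C.emb))^[k] (fun i => mapPoint C.emb (P i))).subset ?_
      rintro _ ⟨⟨k, rfl⟩, hk⟩
      refine ⟨k, ?_, rfl⟩
      simp only [horb] at hk
      obtain ⟨b', hb', -, h⟩ := exists_eq_coe_of_p1Dist_lt_one C.absv (C.nonarch hna) (hle1 k) hk
      rw [hyb, OnePoint.coe_eq_coe] at hb'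
      rwa [hb']
    · refine Set.finite_empty.subset ?_
      rintro _ ⟨⟨k, rfl⟩, hk⟩
      simp only [horb] at hk
      obtain ⟨b, hb, hb1, -⟩ := exists_eq_coe_of_p1Dist_lt_one C.absv (C.nonarch hna) (hle1 k) hk
      exact hyi ⟨b, hb, hb1⟩
  · push Not at hinf
    refine W.infinitelyManyPlaces W.infinite subset_rfl fun j hj w _ => ?_
    refine orbitClosureAvoids_of_finite hP ⟨0, by omega⟩ fun C y _ => ?_
    refine Set.Finite.subset ?_ (Set.sep_subset _ _)
    have hfin : ∀ i, (Set.range fun k : ℕ => (polyEvalP1 f)^[k] (P i)).Finite := by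
      intro i
      refine finite_range_iterate_of_not_injective fun h => ?_
      rcases hPi : P i with _ | x
      · have h1 := @h 0 1
        simp only [hPi] at h1
        exact absurd (h1 ((polyEvalP1_iterate_infty f 0).trans
          (polyEvalP1_iterate_infty f 1).symm)) zero_ne_one
      · refine hinf i x hPi fun k l hkl => h ?_
        simp only [hPi]
        exact (polyEvalP1_iterate_coe f k x).trans
          ((congrArg _ hkl).trans (polyEvalP1_iterate_coe f l x).symm)
    refine ((Set.Finite.pi' hfin).image fun z i => mapPoint C.emb (z i)).subset ?_
    rintro _ ⟨k, rfl⟩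
    refine ⟨(splitMap f)^[k] P, fun i => ⟨k, (splitMap_iterate_apply f k P i).symm⟩, ?_⟩
    exact (splitMap_map_iterate C.emb f k P).symm

section DedekindPlaces

open IsDedekindDomain HeightOneSpectrum Function

lemma one_lt_natCast_of_ne_one {A : Type} [CommRing A] (c : Ideal A →*₀ ℕ)
    (hc : ∀ I, I ≠ ⊥ → c I ≠ 0) {P : HeightOneSpectrum A} (h : c P.asIdeal ≠ 1) :
    (1 : NNReal) < (c P.asIdeal : NNReal) := by
  have := hc _ P.ne_bot
  exact_mod_cast show 1 < c P.asIdeal by omega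

variable {A : Type} [CommRing A] [IsDedekindDomain A] (K : Type) [Field K] [Algebra A K]
  [IsFractionRing A K] (c : Ideal A →*₀ ℕ) (hc : ∀ I, I ≠ ⊥ → c I ≠ 0)

/-- The absolute values of the fraction field of a Dedekind domain attached to those primes whose
multiplicative size is not one, normalized by that size. -/
noncomputable def sizedAbv (P : {P : HeightOneSpectrum A // c P.asIdeal ≠ 1}) :
    AbsoluteValue K ℝ :=
  P.1.adicAbv (one_lt_natCast_of_ne_one c hc P.2)

variable (P : {P : HeightOneSpectrum A // c P.asIdeal ≠ 1})

lemma sizedAbv_add_le (x y : K) :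
    sizedAbv K c hc P (x + y) ≤ max (sizedAbv K c hc P x) (sizedAbv K c hc P y) :=
  isNonarchimedean_adicAbv _ _ x y

lemma sizedAbv_algebraMap_le_one (a : A) : sizedAbv K c hc P (algebraMap A K a) ≤ 1 :=
  adicAbv_coe_le_one _ _ a

lemma sizedAbv_algebraMap_lt_one_iff {a : A} :
    sizedAbv K c hc P (algebraMap A K a) < 1 ↔ a ∈ P.1.asIdeal :=
  adicAbv_coe_lt_one_iff _ _ a

lemma sizedAbv_algebraMap_eq_one_iff {a : A} :
    sizedAbv K c hc P (algebraMap A K a) = 1 ↔ a ∉ P.1.asIdeal :=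
  adicAbv_coe_eq_one_iff _ _ a

lemma sizedAbv_separating {P Q : {P : HeightOneSpectrum A // c P.asIdeal ≠ 1}} (h : P ≠ Q) :
    ∃ x : K, sizedAbv K c hc P x < 1 ∧ ¬ sizedAbv K c hc Q x < 1 := by
  obtain ⟨a, haP, haQ⟩ : ∃ a ∈ P.1.asIdeal, a ∉ Q.1.asIdeal := by
    by_contra! hle
    exact h (Subtype.ext (HeightOneSpectrum.ext (P.1.isMaximal.eq_of_le Q.1.isPrime.ne_top hle)))
  exact ⟨algebraMap A K a, (sizedAbv_algebraMap_lt_one_iff K c hc P).2 haP,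
    (sizedAbv_algebraMap_lt_one_iff K c hc Q).not.2 haQ⟩

lemma sizedAbv_eq_zpow {x : K} (hx : x ≠ 0) :
    sizedAbv K c hc P x = (c P.1.asIdeal : ℝ) ^
      (WithZero.unzero ((P.1.valuation K).ne_zero_iff.2 hx)).toAdd := by
  change ((WithZeroMulInt.toNNReal (ne_zero_of_lt (one_lt_natCast_of_ne_one c hc P.2))
    (P.1.valuation K x) : NNReal) : ℝ) = _
  rw [WithZeroMulInt.toNNReal_neg_apply _ ((P.1.valuation K).ne_zero_iff.2 hx)]
  push_cast
  rfl

lemma sizedAbv_le_half {x : K} (h : sizedAbv K c hc P x < 1) : sizedAbv K c hc P x ≤ 1 / 2 := by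
  by_cases hx : x = 0
  · rw [hx, map_zero]; norm_num
  have h2 : (2 : ℝ) ≤ c P.1.asIdeal := by
    have := one_lt_natCast_of_ne_one c hc P.2
    exact_mod_cast this
  rw [sizedAbv_eq_zpow K c hc P hx] at h ⊢
  generalize Multiplicative.toAdd _ = k at h ⊢
  have hk0 : k < 0 := (zpow_lt_one_iff_right₀ (by linarith)).1 h
  calc (c P.1.asIdeal : ℝ) ^ k ≤ (c P.1.asIdeal : ℝ) ^ (-1 : ℤ) :=
        zpow_le_zpow_right₀ (by linarith) (by omega)
    _ ≤ 1 / 2 := by rw [zpow_neg_one, one_div]; gcongr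

lemma finite_mulSupport_sizedAbv_algebraMap {a : A} (ha : a ≠ 0) :
    {P | sizedAbv K c hc P (algebraMap A K a) ≠ 1}.Finite := by
  have h := Ideal.finite_factors (I := Ideal.span {a}) (by simpa using ha)
  refine (h.preimage Subtype.val_injective.injOn).subset fun P hP => ?_
  have := (sizedAbv_algebraMap_eq_one_iff K c hc P).not_left.1 hP
  simpa [Ideal.dvd_span_singleton] using this

lemma finite_mulSupport_sizedAbv {x : K} (hx : x ≠ 0) :
    {P | sizedAbv K c hc P x ≠ 1}.Finite := by
  obtain ⟨a, b, hb, rfl⟩ := IsFractionRing.div_surjective A x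
  have hb := nonZeroDivisors.ne_zero hb
  have ha : a ≠ 0 := by rintro rfl; simp at hx
  refine ((finite_mulSupport_sizedAbv_algebraMap K c hc ha).union
    (finite_mulSupport_sizedAbv_algebraMap K c hc hb)).subset fun P hP => ?_
  by_contra! h
  simp only [Set.mem_union, Set.mem_ofPred_eq, not_or, not_not] at h
  exact hP (by rw [map_div₀, h.1, h.2, div_one])

lemma sizedAbv_mul_size {a : A} (ha : a ≠ 0) :
    sizedAbv K c hc P (algebraMap A K a) * c (P.1.maxPowDividing (Ideal.span {a})) = 1 := by
  have hb := one_lt_natCast_of_ne_one c hc P.2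
  rw [sizedAbv_eq_zpow K c hc P ((FaithfulSMul.algebraMap_eq_zero_iff A K).not.2 ha),
    maxPowDividing, map_pow, Nat.cast_pow, ← zpow_natCast,
    ← zpow_add₀ (mod_cast (zero_lt_one.trans hb).ne')]
  norm_cast
  rw [zpow_eq_one_iff_right₀ (Nat.cast_nonneg' _) (mod_cast hb.ne')]
  rw [add_eq_zero_iff_eq_neg, ← toAdd_ofAdd (-_), Multiplicative.toAdd.injective.eq_iff,
    ← WithZero.coe_inj, WithZero.coe_unzero, valuation_of_algebraMap, intValuation_if_neg _ ha]
  rfl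

lemma finprod_sizedAbv_algebraMap {a : A} (ha : a ≠ 0) :
    ∏ᶠ P, sizedAbv K c hc P (algebraMap A K a) = (c (Ideal.span {a}) : ℝ)⁻¹ := by
  have hI : Ideal.span {a} ≠ 0 := by simpa using ha
  refine (inv_eq_of_mul_eq_one_left ?_).symm
  have h1 : (c (Ideal.span {a}) : ℝ) =
      ∏ᶠ P : {P : HeightOneSpectrum A // c P.asIdeal ≠ 1},
        (c (P.1.maxPowDividing (Ideal.span {a})) : ℝ) := by
    have h := congrArg (fun I => (c I : ℝ)) (Ideal.finprod_heightOneSpectrum_factorization hI)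
    beta_reduce at h
    refine h.symm.trans (((Nat.castRingHom ℝ).toMonoidHom.comp c.toMonoidHom).map_finprod
      (Ideal.hasFiniteMulSupport hI) |>.trans ?_)
    change ∏ᶠ P : HeightOneSpectrum A, (c (P.maxPowDividing (Ideal.span {a})) : ℝ) = _
    rw [finprod_subtype_eq_finprod_cond (fun P : HeightOneSpectrum A => c P.asIdeal ≠ 1)
      (f := fun P => (c (P.maxPowDividing (Ideal.span {a})) : ℝ))]
    refine finprod_congr fun P => ?_
    by_cases h : c P.asIdeal = 1
    · simp [h, maxPowDividing]
    · simp [h]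
  have hf : {P : {P : HeightOneSpectrum A // c P.asIdeal ≠ 1} |
      (c (P.1.maxPowDividing (Ideal.span {a})) : ℝ) ≠ 1}.Finite := by
    refine (finite_mulSupport_sizedAbv_algebraMap K c hc ha).subset fun P hP h => hP ?_
    have := sizedAbv_mul_size K c hc P ha
    rwa [h, one_mul] at this
  rw [h1, ← finprod_mul_distrib (finite_mulSupport_sizedAbv_algebraMap K c hc ha) hf]
  exact finprod_eq_one_of_forall_eq_one fun P => sizedAbv_mul_size K c hc P ha

lemma finprod_sizedAbv {M : K →*₀ ℝ} (hM : ∀ a : A, M (algebraMap A K a) = c (Ideal.span {a}))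
    {x : K} (hx : x ≠ 0) : ∏ᶠ P, sizedAbv K c hc P x = (M x)⁻¹ := by
  obtain ⟨a, b, hb, rfl⟩ := IsFractionRing.div_surjective A x
  have hb := nonZeroDivisors.ne_zero hb
  have ha : a ≠ 0 := by rintro rfl; simp at hx
  simp_rw [map_div₀]
  rw [finprod_div_distrib (finite_mulSupport_sizedAbv_algebraMap K c hc ha)
    (finite_mulSupport_sizedAbv_algebraMap K c hc hb), finprod_sizedAbv_algebraMap K c hc ha,
    finprod_sizedAbv_algebraMap K c hc hb, hM, hM, inv_div_inv, inv_div]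

end DedekindPlaces

section PlacesOver

variable {R F : Type} [CommRing R] [Field F] (K : Type) [Field K] [Algebra F K]

/-- A family of discrete absolute values of `K` centred at the primes of `R` of size different from
one, whose product is the inverse of the size of the norm. -/
structure PlacesOver (φ : R →+* F) (c : Ideal R →*₀ ℕ) (M : F →*₀ ℝ) where
  ι : Type
  v : ι → AbsoluteValue K ℝ
  nonarch : ∀ i x y, v i (x + y) ≤ max (v i x) (v i y)
  separating : ∀ i j, i ≠ j → ∃ x, v i x < 1 ∧ ¬ v j x < 1
  discrete : ∀ i x, v i x < 1 → v i x ≤ 1 / 2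
  finite_support : ∀ x ≠ 0, {i | v i x ≠ 1}.Finite
  finprod_eq : ∀ x ≠ 0, ∏ᶠ i, v i x = (M (Algebra.norm F x))⁻¹
  le_one : ∀ i r, v i (algebraMap F K (φ r)) ≤ 1
  exists_center : ∀ i, ∃ p : Ideal R, p.IsPrime ∧ p ≠ ⊥ ∧ c p ≠ 1 ∧
    ∀ r ∈ p, v i (algebraMap F K (φ r)) < 1

theorem nonempty_placesOver [IsDedekindDomain R] [CharZero F] [FiniteDimensional F K]
    (φ : R →+* F) (hφ : Function.Injective φ) (hfrac : ∀ y, ∃ a b, b ≠ 0 ∧ y = φ a / φ b)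
    (c : Ideal R →*₀ ℕ) (hc : ∀ I, I ≠ ⊥ → c I ≠ 0) (M : F →*₀ ℝ)
    (hM : ∀ r, M (φ r) = c (Ideal.span {r})) : Nonempty (PlacesOver K φ c M) := by
  let : Algebra R F := φ.toAlgebra
  let : Algebra R K := ((algebraMap F K).comp φ).toAlgebra
  have : IsScalarTower R F K := IsScalarTower.of_algebraMap_eq' rfl
  have : FaithfulSMul R F := (faithfulSMul_iff_algebraMap_injective R F).2 hφ
  have : IsFractionRing R F := IsFractionRing.of_field R F fun z => by
    obtain ⟨a, b, -, h⟩ := hfrac z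
    exact ⟨a, b, h⟩
  let A := integralClosure R K
  have : IsDedekindDomain A := integralClosure.isDedekindDomain R F K
  have : IsFractionRing A K := integralClosure.isFractionRing_of_finite_extension F K
  have : Module.Finite R A := IsIntegralClosure.finite R F K A
  have : FaithfulSMul R K := (faithfulSMul_iff_algebraMap_injective R K).2
    ((algebraMap F K).injective.comp hφ)
  have : Module.IsTorsionFree R A := inferInstance
  let cA : Ideal A →*₀ ℕ := c.comp (Ideal.relNorm R)
  have hcA : ∀ I, I ≠ ⊥ → cA I ≠ 0 := fun I hI => hc _ (Ideal.relNorm_eq_bot_iff.not.2 hI)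
  let normHom : K →*₀ F := { Algebra.norm F with map_zero' := Algebra.norm_zero }
  refine ⟨⟨_, sizedAbv K cA hcA, sizedAbv_add_le K cA hcA,
    fun i j => sizedAbv_separating K cA hcA, fun i x => sizedAbv_le_half K cA hcA i,
    fun x => finite_mulSupport_sizedAbv K cA hcA,
    fun x hx => finprod_sizedAbv K cA hcA (M := M.comp normHom) (fun a => ?_) hx,
    fun i r => sizedAbv_algebraMap_le_one K cA hcA i (algebraMap R A r),
    fun i => ⟨i.1.asIdeal.under R, inferInstance, ?_, fun h => i.2 ?_, fun r hr =>
      (sizedAbv_algebraMap_lt_one_iff K cA hcA i (a := algebraMap R A r)).2 hr⟩⟩⟩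
  · change M (Algebra.norm F (algebraMap A K a)) = (c (Ideal.relNorm R (Ideal.span {a})) : ℝ)
    rw [Ideal.relNorm_singleton, ← hM, ← Algebra.algebraMap_intNorm (A := R)]
    rfl
  · exact Ideal.under_ne_bot R i.1.ne_bot
  · obtain ⟨s, hs⟩ := Ideal.exists_relNorm_eq_pow_of_isPrime i.1.asIdeal (i.1.asIdeal.under R)
    change c (Ideal.relNorm R i.1.asIdeal) = 1
    rw [hs, map_pow, h, one_pow]

end PlacesOver

namespace PlacesOver

variable {R F K : Type} [CommRing R] [Field F] [Field K] [Algebra F K] {φ : R →+* F}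
  {c : Ideal R →*₀ ℕ} {M : F →*₀ ℝ} (W : PlacesOver K φ c M)

lemma eq_one_of_isUnit {r : R} (hr : IsUnit r) (i : W.ι) : W.v i (algebraMap F K (φ r)) = 1 := by
  obtain ⟨u, rfl⟩ := hr
  refine le_antisymm (W.le_one i _) ?_
  have h : W.v i (algebraMap F K (φ u)) * W.v i (algebraMap F K (φ ↑u⁻¹)) = 1 := by
    rw [← map_mul, ← map_mul, ← map_mul, Units.mul_inv, map_one, map_one, map_one]
  rw [← h]
  exact mul_le_of_le_one_right (apply_nonneg _ _) (W.le_one i _)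

variable [FiniteDimensional F K]

lemma exists_lt_one (hM : ∀ r, M (φ r) = c (Ideal.span {r})) {r : R}
    (h0 : φ r ≠ 0) (hr : c (Ideal.span {r}) ≠ 1) :
    ∃ i, W.v i (algebraMap F K (φ r)) < 1 := by
  by_contra! h
  have h1 : ∀ i, W.v i (algebraMap F K (φ r)) = 1 := fun i => le_antisymm (W.le_one i r) (h i)
  have h2 := W.finprod_eq (algebraMap F K (φ r)) (by simpa using h0)
  simp only [h1, finprod_one, Algebra.norm_algebraMap, map_pow, hM] at h2
  rw [eq_comm, inv_eq_one, ← Nat.cast_pow, Nat.cast_eq_one] at h2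
  exact hr ((Nat.pow_eq_one.1 h2).resolve_right Module.finrank_pos.ne')

lemma infinite (hM : ∀ r, M (φ r) = c (Ideal.span {r})) {p : ℕ → R}
    (hcop : Pairwise fun m n => IsCoprime (p m) (p n)) (h0 : ∀ n, φ (p n) ≠ 0)
    (hp : ∀ n, c (Ideal.span {p n}) ≠ 1) : Infinite W.ι := by
  choose g hg using fun n => W.exists_lt_one hM (h0 n) (hp n)
  refine Infinite.of_injective g fun m n hmn => ?_
  by_contra hne
  obtain ⟨a, b, hab⟩ := hcop hne
  have h := W.nonarch (g m) (algebraMap F K (φ (a * p m))) (algebraMap F K (φ (b * p n)))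
  rw [← map_add, ← map_add, hab, map_one, map_one, map_one] at h
  refine absurd (h.trans_lt (max_lt ?_ ?_)) (lt_irrefl _)
  · rw [map_mul, map_mul, map_mul]
    exact mul_lt_one_of_nonneg_of_lt_one_right (W.le_one _ _) (apply_nonneg _ _) (hg m)
  · rw [map_mul, map_mul, map_mul, hmn]
    exact mul_lt_one_of_nonneg_of_lt_one_right (W.le_one _ _) (apply_nonneg _ _) (hg n)

/-- Finitely many absolute values whose product is the size of the norm complete the places over
a Dedekind domain to a family satisfying the product formula. -/
theorem nonempty_productFormulaPlaces (hM : ∀ r, M (φ r) = c (Ideal.span {r}))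
    {κ : Subfield K} {ι' : Type} [Finite ι']
    (v' : ι' → AbsoluteValue K ℝ) (hv' : ∀ x ≠ 0, ∏ᶠ j, v' j x = M (Algebra.norm F x))
    (hκ : NumberField K ∨ ∀ i, ∀ c ∈ κ, c ≠ 0 → W.v i c = 1) {p : ℕ → R}
    (hcop : Pairwise fun m n => IsCoprime (p m) (p n)) (h0 : ∀ n, φ (p n) ≠ 0)
    (hp : ∀ n, c (Ideal.span {p n}) ≠ 1) : Nonempty (ProductFormulaPlaces K κ) := by
  have hinf := W.infinite hM hcop h0 hp
  have hfin : ∀ x : K, x ≠ 0 → {i | Sum.elim W.v v' i x ≠ 1}.Finite := fun x hx => by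
    refine (((W.finite_support x hx).image Sum.inl).union
      ((Set.toFinite Set.univ).image Sum.inr)).subset ?_
    rintro (i | j) h
    · exact Or.inl ⟨i, h, rfl⟩
    · exact Or.inr ⟨j, trivial, rfl⟩
  refine ⟨⟨W.ι ⊕ ι', Sum.elim W.v v', Set.range Sum.inl, ?_, ?_, ?_, ?_, ?_, ?_, hfin, ?_⟩⟩
  · rw [Set.compl_range_inl]
    exact Set.finite_range _
  · exact Set.infinite_range_of_injective Sum.inl_injective
  · rintro _ ⟨i, rfl⟩
    exact W.nonarch i
  · refine hκ.imp id fun h => ?_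
    rintro _ ⟨i, rfl⟩
    exact h i
  · rintro _ ⟨i, rfl⟩ _ ⟨j, rfl⟩ hij
    exact W.separating i j fun h => hij (by rw [h])
  · rintro _ ⟨i, rfl⟩
    exact W.discrete i
  · intro x hx
    rw [← finprod_mem_univ, ← Set.range_inl_union_range_inr,
      finprod_mem_union' Set.isCompl_range_inl_range_inr.disjoint ((hfin x hx).inter_of_right _)
        ((hfin x hx).inter_of_right _),
      finprod_mem_range Sum.inl_injective, finprod_mem_range Sum.inr_injective]
    change (∏ᶠ i, W.v i x) * ∏ᶠ j, v' j x = 1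
    rw [W.finprod_eq x hx, hv' x hx, inv_mul_cancel₀]
    exact (map_ne_zero M).2 (Algebra.norm_ne_zero_iff.2 hx)

end PlacesOver

theorem NumberField.nonempty_productFormulaPlaces {K : Type} [Field K] [NumberField K]
    (κ : Subfield K) : Nonempty (ProductFormulaPlaces K κ) := by
  let M : ℚ →*₀ ℝ := (Rat.castHom ℝ).toMonoidWithZeroHom |> (absHom : ℝ →*₀ ℝ).comp
  have hM : ∀ r : ℤ, M (Int.castRingHom ℚ r) = Ideal.absNorm (Ideal.span {r}) := fun r => by
    rw [Ideal.absNorm_span_singleton, Algebra.norm_self, MonoidHom.id_apply, Nat.cast_natAbs,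
      Int.cast_abs]
    change |((r : ℚ) : ℝ)| = |(r : ℝ)|
    rw [Rat.cast_intCast]
  obtain ⟨W⟩ := nonempty_placesOver K (Int.castRingHom ℚ) Int.cast_injective
    (fun y => ⟨y.num, y.den, by exact_mod_cast y.den_ne_zero, y.num_div_den.symm⟩) Ideal.absNorm
    (fun I hI => Ideal.absNorm_eq_zero_iff.not.2 hI) M hM
  refine W.nonempty_productFormulaPlaces hM
    (fun σ : K →ₐ[ℚ] ℂ => NumberField.place (σ : K →+* ℂ)) (fun x _ => ?_) (Or.inl ‹_›)
    (p := fun n => (Nat.nth Nat.Prime n : ℤ)) (fun m n hmn => ?_) (fun n => ?_) fun n => ?_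
  · rw [finprod_eq_prod_of_fintype]
    have h := congrArg norm (Algebra.norm_eq_prod_embeddings ℚ ℂ x)
    rw [norm_prod] at h
    refine h.symm.trans ?_
    change ‖((Algebra.norm ℚ x : ℚ) : ℂ)‖ = |((Algebra.norm ℚ x : ℚ) : ℝ)|
    rw [← Complex.ofReal_ratCast, Complex.norm_real, Real.norm_eq_abs]
  · beta_reduce
    rw [Nat.isCoprime_iff_coprime, Nat.coprime_primes (Nat.prime_nth_prime m)
      (Nat.prime_nth_prime n)]
    exact (Nat.nth_injective Nat.infinite_setOfPred_prime).ne hmn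
  · simpa using (Nat.prime_nth_prime n).ne_zero
  · rw [Ideal.absNorm_span_singleton, Algebra.norm_self, MonoidHom.id_apply, Int.natAbs_natCast]
    exact (Nat.prime_nth_prime n).ne_one

section PrincipalSize

variable {R : Type} [CommRing R] [IsDomain R]

lemma eq_of_associated_of_additive {d : R → ℕ}
    (hd : ∀ a b, a ≠ 0 → b ≠ 0 → d (a * b) = d a + d b) {a b : R} (ha : a ≠ 0)
    (h : Associated a b) : d a = d b := by
  obtain ⟨u, rfl⟩ := h
  have h1 := hd 1 1 one_ne_zero one_ne_zero
  have h2 := hd u ↑u⁻¹ u.ne_zero u⁻¹.ne_zero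
  rw [mul_one] at h1
  rw [Units.mul_inv] at h2
  rw [hd a u ha u.ne_zero]
  omega

open Classical in
/-- The size `2 ^ d` of principal ideals attached to an additive degree `d` on nonzero elements. -/
noncomputable def principalSizeFun [IsPrincipalIdealRing R] (d : R → ℕ) (I : Ideal R) : ℕ :=
  if I = ⊥ then 0 else 2 ^ d (Submodule.IsPrincipal.generator I)

variable [IsPrincipalIdealRing R] {d : R → ℕ}

lemma principalSizeFun_span (hd : ∀ a b, a ≠ 0 → b ≠ 0 → d (a * b) = d a + d b) {a : R}
    (ha : a ≠ 0) : principalSizeFun d (Ideal.span {a}) = 2 ^ d a := by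
  rw [principalSizeFun, if_neg (by simpa using ha)]
  congr 1
  exact (eq_of_associated_of_additive hd ha
    (Submodule.IsPrincipal.associated_generator_span_self a).symm).symm

variable (hd : ∀ a b, a ≠ 0 → b ≠ 0 → d (a * b) = d a + d b)

/-- The size `2 ^ d` of principal ideals as a multiplicative map. -/
noncomputable def principalSize : Ideal R →*₀ ℕ where
  toFun := principalSizeFun d
  map_zero' := if_pos rfl
  map_one' := by
    have h1 := hd 1 1 one_ne_zero one_ne_zero
    rw [mul_one] at h1
    rw [Ideal.one_eq_top, ← Ideal.span_singleton_one, principalSizeFun_span hd one_ne_zero,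
      show d 1 = 0 by omega, pow_zero]
  map_mul' I J := by
    obtain ⟨a, rfl⟩ := IsPrincipalIdealRing.principal I
    obtain ⟨b, rfl⟩ := IsPrincipalIdealRing.principal J
    change principalSizeFun d (Ideal.span {a} * Ideal.span {b}) =
      principalSizeFun d (Ideal.span {a}) * principalSizeFun d (Ideal.span {b})
    by_cases ha : a = 0
    · simp [ha, principalSizeFun]
    by_cases hb : b = 0
    · simp [hb, principalSizeFun]
    rw [Ideal.span_singleton_mul_span_singleton, principalSizeFun_span hd ha,
      principalSizeFun_span hd hb, principalSizeFun_span hd (mul_ne_zero ha hb), hd a b ha hb,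
      pow_add]

lemma principalSize_span {a : R} (ha : a ≠ 0) :
    principalSize hd (Ideal.span {a}) = 2 ^ d a :=
  principalSizeFun_span hd ha

lemma principalSize_ne_zero {I : Ideal R} (hI : I ≠ ⊥) : principalSize hd I ≠ 0 := by
  change principalSizeFun d I ≠ 0
  rw [principalSizeFun, if_neg hI]
  positivity

end PrincipalSize

namespace RatFunc

variable (k : Type) [Field k]

/-- The inclusion of polynomials in `X⁻¹` into rational functions. -/
noncomputable def invXHom : k[X] →+* RatFunc k :=
  eval₂RingHom RatFunc.C (RatFunc.X)⁻¹

lemma invXHom_X : invXHom k Polynomial.X = (RatFunc.X)⁻¹ := by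
  simp [invXHom]

variable {k}

lemma eval₂_C_X_eq (p : k[X]) :
    eval₂ RatFunc.C RatFunc.X p = algebraMap k[X] (RatFunc k) p := by
  rw [← RatFunc.algebraMap_X, ← RatFunc.algebraMap_eq_C]
  rw [IsScalarTower.algebraMap_eq k k[X] (RatFunc k), ← hom_eval₂]
  simp

lemma invXHom_reverse_mul (p : k[X]) :
    invXHom k p.reverse * RatFunc.X ^ p.natDegree = algebraMap k[X] (RatFunc k) p := by
  let := invertibleOfNonzero (RatFunc.X_ne_zero (K := k))
  have h := eval₂_reverse_mul_pow (RatFunc.C) (RatFunc.X : RatFunc k) p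
  rwa [invOf_eq_inv, eval₂_C_X_eq] at h

lemma invXHom_eq (p : k[X]) :
    invXHom k p = algebraMap k[X] (RatFunc k) p.reverse * (RatFunc.X⁻¹) ^ p.natDegree := by
  let := invertibleOfNonzero (inv_ne_zero (RatFunc.X_ne_zero (K := k)))
  have h := eval₂_reverse_mul_pow (RatFunc.C) (RatFunc.X⁻¹ : RatFunc k) p
  rw [invOf_eq_inv, inv_inv, eval₂_C_X_eq] at h
  exact h.symm

lemma invXHom_injective : Function.Injective (invXHom k) := by
  rw [injective_iff_map_eq_zero]
  intro p hp
  rw [invXHom_eq, mul_eq_zero] at hp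
  have := hp.resolve_right (pow_ne_zero _ (inv_ne_zero RatFunc.X_ne_zero))
  simpa using this

lemma exists_eq_invXHom_div (y : RatFunc k) :
    ∃ a b, b ≠ 0 ∧ y = invXHom k a / invXHom k b := by
  refine ⟨y.num.reverse * Polynomial.X ^ y.denom.natDegree,
    y.denom.reverse * Polynomial.X ^ y.num.natDegree,
    mul_ne_zero (by simpa using y.denom_ne_zero) (pow_ne_zero _ Polynomial.X_ne_zero), ?_⟩
  have hX := RatFunc.X_ne_zero (K := k)
  have hd : invXHom k y.denom.reverse ≠ 0 :=
    (map_ne_zero_iff _ invXHom_injective).2 (by simpa using y.denom_ne_zero)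
  conv_lhs => rw [← RatFunc.num_div_denom y, ← invXHom_reverse_mul, ← invXHom_reverse_mul]
  rw [map_mul, map_mul, map_pow, map_pow, invXHom_X, inv_pow, inv_pow]
  field_simp

lemma intDegree_invXHom {p : k[X]} (hp : p ≠ 0) :
    (invXHom k p).intDegree = -(p.natTrailingDegree : ℤ) := by
  have hX := RatFunc.X_ne_zero (K := k)
  have hpow : ∀ n : ℕ, ((RatFunc.X⁻¹ : RatFunc k) ^ n).intDegree = -(n : ℤ) := fun n => by
    rw [inv_pow, intDegree_inv, ← RatFunc.algebraMap_X, ← map_pow, intDegree_polynomial,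
      natDegree_X_pow]
  rw [invXHom_eq, intDegree_mul (by simpa using hp) (pow_ne_zero _ (inv_ne_zero hX)), hpow,
    intDegree_polynomial, reverse_natDegree]
  have := p.natTrailingDegree_le_natDegree
  omega

variable (k) in
open Classical in
/-- The absolute value at infinity `2 ^ deg` of rational functions, as a multiplicative map. -/
noncomputable def degreeSize : RatFunc k →*₀ ℝ where
  toFun y := if y = 0 then 0 else 2 ^ y.intDegree
  map_zero' := if_pos rfl
  map_one' := by simp
  map_mul' x y := by
    by_cases hx : x = 0
    · simp [hx]
    by_cases hy : y = 0
    · simp [hy]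
    rw [if_neg hx, if_neg hy, if_neg (mul_ne_zero hx hy), intDegree_mul hx hy,
      zpow_add₀ two_ne_zero]

lemma degreeSize_of_ne_zero {y : RatFunc k} (hy : y ≠ 0) :
    degreeSize k y = 2 ^ y.intDegree :=
  if_neg hy

variable (k) in
/-- The inverse of the absolute value at infinity. -/
noncomputable def codegreeSize : RatFunc k →*₀ ℝ :=
  invMonoidWithZeroHom.comp (degreeSize k)

lemma codegreeSize_apply (y : RatFunc k) : codegreeSize k y = (degreeSize k y)⁻¹ := rfl

variable (k) in
/-- The size `2 ^ deg` of ideals of `k[X]`. -/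
noncomputable def idealDegreeSize : Ideal k[X] →*₀ ℕ :=
  principalSize (d := natDegree) fun _ _ => natDegree_mul

variable (k) in
/-- The size `2 ^ ord₀` of ideals of `k[X]`. -/
noncomputable def idealOrderSize : Ideal k[X] →*₀ ℕ :=
  principalSize (d := natTrailingDegree) fun _ _ => natTrailingDegree_mul

lemma degreeSize_algebraMap (p : k[X]) :
    degreeSize k (algebraMap k[X] (RatFunc k) p) = idealDegreeSize k (Ideal.span {p}) := by
  by_cases hp : p = 0
  · rw [hp, Ideal.span_singleton_eq_bot.2 rfl, ← Ideal.zero_eq_bot]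
    simp only [map_zero, Nat.cast_zero]
  rw [degreeSize_of_ne_zero (by simpa using hp), idealDegreeSize, principalSize_span _ hp,
    intDegree_polynomial, zpow_natCast, Nat.cast_pow, Nat.cast_ofNat]

lemma codegreeSize_invXHom (p : k[X]) :
    codegreeSize k (invXHom k p) = idealOrderSize k (Ideal.span {p}) := by
  by_cases hp : p = 0
  · rw [hp, Ideal.span_singleton_eq_bot.2 rfl, ← Ideal.zero_eq_bot]
    simp only [map_zero, Nat.cast_zero]
  rw [codegreeSize_apply, degreeSize_of_ne_zero ((map_ne_zero_iff _ invXHom_injective).2 hp),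
    idealOrderSize, principalSize_span _ hp, intDegree_invXHom hp, zpow_neg, inv_inv,
    zpow_natCast, Nat.cast_pow, Nat.cast_ofNat]

lemma X_mem_of_idealOrderSize_ne_one {I : Ideal k[X]} (hI : I.IsPrime)
    (h : idealOrderSize k I ≠ 1) (h0 : I ≠ ⊥) : Polynomial.X ∈ I := by
  obtain ⟨a, rfl⟩ := IsPrincipalIdealRing.principal I
  change Ideal.IsPrime (Ideal.span {a}) at hI
  change Ideal.span {a} ≠ ⊥ at h0
  change idealOrderSize k (Ideal.span {a}) ≠ 1 at h
  change Polynomial.X ∈ Ideal.span {a}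
  have ha : a ≠ 0 := by simpa using h0
  rw [idealOrderSize, principalSize_span _ ha] at h
  have hXa : Polynomial.X ∣ a := by
    rw [X_dvd_iff]
    by_contra hc
    exact h (by rw [natTrailingDegree_eq_zero.2 (Or.inr hc), pow_zero])
  rw [Ideal.span_singleton_prime ha] at hI
  exact Ideal.mem_span_singleton.2
    ((Polynomial.prime_X.irreducible.associated_of_dvd hI.irreducible hXa).symm.dvd)

end RatFunc

section FunctionField

variable {K : Type} [Field K]

theorem PlacesOver.finite_of_invXHom {k : Type} [Field k] [Algebra (RatFunc k) K]
    (W : PlacesOver K (RatFunc.invXHom k) (RatFunc.idealOrderSize k) (RatFunc.codegreeSize k)) :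
    Finite W.ι := by
  have hX : algebraMap (RatFunc k) K (RatFunc.invXHom k X) ≠ 0 := by
    simpa using (map_ne_zero_iff _ RatFunc.invXHom_injective).2 (X_ne_zero (R := k))
  refine Set.finite_univ_iff.1 ((W.finite_support _ hX).subset fun i _ => ?_)
  obtain ⟨p, hp, h0, hc, hlt⟩ := W.exists_center i
  exact (hlt _ (RatFunc.X_mem_of_idealOrderSize_ne_one hp hc h0)).ne

theorem nonempty_productFormulaPlaces_of_ratFunc [CharZero K] (κ : Subfield K)
    [Algebra (RatFunc κ) K] [FiniteDimensional (RatFunc κ) K]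
    (hC : ∀ c : κ, algebraMap (RatFunc κ) K (RatFunc.C c) = c) :
    Nonempty (ProductFormulaPlaces K κ) := by
  have : CharZero (RatFunc κ) :=
    ((algebraMap (RatFunc κ) K).charZero_iff (RingHom.injective _)).2 ‹_›
  obtain ⟨W₁⟩ := nonempty_placesOver K (algebraMap κ[X] (RatFunc κ))
    (RatFunc.algebraMap_injective κ)
    (fun y => ⟨y.num, y.denom, y.denom_ne_zero, (RatFunc.num_div_denom y).symm⟩)
    (RatFunc.idealDegreeSize κ) (fun _ => principalSize_ne_zero _) (RatFunc.degreeSize κ)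
    RatFunc.degreeSize_algebraMap
  obtain ⟨W₂⟩ := nonempty_placesOver K (RatFunc.invXHom κ)
    RatFunc.invXHom_injective RatFunc.exists_eq_invXHom_div
    (RatFunc.idealOrderSize κ) (fun _ => principalSize_ne_zero _) (RatFunc.codegreeSize κ)
    RatFunc.codegreeSize_invXHom
  have := W₂.finite_of_invXHom
  refine W₁.nonempty_productFormulaPlaces RatFunc.degreeSize_algebraMap W₂.v
    (fun x hx => ?_) (Or.inr fun i c hc h0 => ?_) (p := fun n => X - C (n : κ))
    (fun m n hmn => ?_) (fun n => ?_) fun n => ?_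
  · rw [W₂.finprod_eq x hx, RatFunc.codegreeSize_apply, inv_inv]
  · have hu : IsUnit (C (⟨c, hc⟩ : κ)) :=
      isUnit_C.2 (Ne.isUnit fun h => h0 (congrArg Subtype.val h))
    have h := W₁.eq_one_of_isUnit hu i
    rwa [RatFunc.algebraMap_C, hC] at h
  · exact isCoprime_X_sub_C_of_isUnit_sub (Ne.isUnit (sub_ne_zero.2 (by exact_mod_cast hmn)))
  · exact (map_ne_zero_iff _ (RatFunc.algebraMap_injective κ)).2 (X_sub_C_ne_zero (n : κ))
  · rw [RatFunc.idealDegreeSize, principalSize_span _ (X_sub_C_ne_zero _), natDegree_X_sub_C]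
    norm_num

open IntermediateField in
theorem nonempty_productFormulaPlaces_of_transcendental [CharZero K] (κ : Subfield K) {t : K}
    (ht : Transcendental κ t) (hfin : FiniteDimensional κ⟮t⟯ K) :
    Nonempty (ProductFormulaPlaces K κ) := by
  let e := RatFunc.algEquivOfTranscendental t ht
  let := ((algebraMap κ⟮t⟯ K).comp (e : RatFunc κ →+* κ⟮t⟯)).toAlgebra
  have : FiniteDimensional (RatFunc κ) K :=
    Module.Finite.of_equiv_equiv (e.symm : κ⟮t⟯ ≃+* RatFunc κ) (RingEquiv.refl K) (by
      ext x
      change algebraMap κ⟮t⟯ K (e (e.symm x)) = _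
      rw [e.apply_symm_apply]
      rfl)
  refine nonempty_productFormulaPlaces_of_ratFunc κ fun c => ?_
  change algebraMap κ⟮t⟯ K (e (RatFunc.C c)) = c
  rw [← RatFunc.algebraMap_eq_C, e.commutes]
  rfl

end FunctionField

/-- **Dynamical Hasse principle for zero-dimensional subvarieties** (Theorem 3.5(a)).

Let `K` be a number field or a function field of characteristic 0, `n ≥ 2`, `f ∈ K[X]` of
degree at least 2, and `φ = (f,…,f)`. Let `V` be a zero-dimensional closed subvariety of
`(P^1_K)^n`. For every `P ∈ (P^1)^n(K)` whose `φ`-orbit does not meet `V(K)` there are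
infinitely many non-archimedean places `𝔭` of `K` such that `V(K_𝔭)` does not meet the
`𝔭`-adic closure of the orbit in `(P^1)^n(K_𝔭)`. -/
theorem dynamical_hasse_principle_zero_dimensional
    (K : Type) [Field K] (κ : Subfield K)
    (hK : NumberFieldOrFunctionFieldOver K κ)
    (n : ℕ) (hn : 2 ≤ n)
    (f : Polynomial K) (hf : 2 ≤ f.natDegree)
    (V : ClosedSubvar K (Fin n))
    (hVdim : varDim (V.pts (algebraMap K (AlgebraicClosure K))) = ((0 : ℕ∞) : WithBot ℕ∞))
    (P : Fin n → OnePoint K)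
    (hP : fwdOrbit (splitMap f) P ∩ V.pts (RingHom.id K) = ∅) :
    InfinitelyManyPlaces K κ fun w => OrbitClosureAvoids w f P V := by
  obtain ⟨W⟩ : Nonempty (ProductFormulaPlaces K κ) := by
    rcases hK with _ | ⟨_, ⟨t, ht, hfin⟩, _⟩
    · exact NumberField.nonempty_productFormulaPlaces κ
    · exact nonempty_productFormulaPlaces_of_transcendental κ ht hfin
  have : CharZero K := by
    rcases hK with h | h
    · exact h.to_charZero
    · exact h.1
  exact infinitelyManyPlaces_orbitClosureAvoids W hn hf hVdim hP
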